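/- Let M > 0, γ₀ > 0, ρ > 0, and for each n ∈ ℤ² let μ_n be a Borel probability measure on ℝ with μ_n([0,M]) = 1 and μ_n({s : |s − t| > γ₀/2}) ≥ ρ for every t ∈ [0,M]. For every sufficiently small ε > 0 there is α = α(ε) > 1 (smallness of ε and value of α depending on M, γ₀, ρ) such that: for every Ē ∈ [0, 8+M], every square Λ ⊆ ℤ² of side length L ≥ α, every F ⊆ ℤ² that is ε-regular in Λ, and every v : F → [0,M], the product measure ⊗_{n∈Λ\F} μ_n of the set of configurations ω : Λ\F → ℝ with the following property is at least 1 − e^{−εL^{1/4}}: writing V = v on F and V = ω on Λ\F, for every E ∈ ℝ and every ψ : ℤ² → ℝ, the three conditions |E − Ē| ≤ e^{−α(L·log L)^{1/2}}, Hψ = Eψ in Λ, and |{n ∈ Λ\F : |ψ(n)| ≤ 1}| ≥ (1 − ε(L·log L)^{−1/2})·|Λ\F| together imply |ψ(n)| ≤ e^{αL·log L} for every n ∈ (1/2)Λ. -/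

import Mathlib

open MeasureTheory ProbabilityTheory
open scoped Classical

noncomputable section

/-- Euclidean distance between two points of `ℤ²`. -/
def eudist (x y : ℤ × ℤ) : ℝ :=
  Real.sqrt ((((x.1 - y.1 : ℤ) : ℝ)) ^ 2 + (((x.2 - y.2 : ℤ) : ℝ)) ^ 2)

/-- The square `([a, a+L−1] × [b, b+L−1]) ∩ ℤ²` of side length `L`. -/
def sqZ (a b : ℤ) (L : ℕ) : Finset (ℤ × ℤ) :=
  Finset.Icc a (a + L - 1) ×ˢ Finset.Icc b (b + L - 1)

/-- The truncated Hamiltonian `H_Λ`: the `Λ×Λ` matrix with diagonal entries `4 + V x`,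
entries `−1` between nearest neighbours (`‖x−y‖₁ = 1`) and `0` otherwise. -/
def Ham (V : ℤ × ℤ → ℝ) (Λ : Finset (ℤ × ℤ)) : Matrix Λ Λ ℝ :=
  fun x y =>
    if (x : ℤ × ℤ) = (y : ℤ × ℤ) then 4 + V x
    else if ((x : ℤ × ℤ).1 - (y : ℤ × ℤ).1).natAbs + ((x : ℤ × ℤ).2 - (y : ℤ × ℤ).2).natAbs = 1
      then -1 else 0

/-- Entries of a `Λ×Λ` matrix, extended by `0` outside `Λ`. -/
def entry {Λ : Finset (ℤ × ℤ)} (A : Matrix Λ Λ ℝ) (x y : ℤ × ℤ) : ℝ :=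
  if hx : x ∈ Λ then (if hy : y ∈ Λ then A ⟨x, hx⟩ ⟨y, hy⟩ else 0) else 0

/-- Extension by zero of a potential defined on `Λ`. -/
def extV (Λ : Finset (ℤ × ℤ)) (V : Λ → ℝ) : ℤ × ℤ → ℝ :=
  fun n => if h : n ∈ Λ then V ⟨n, h⟩ else 0

/-- `ψ` satisfies `Hψ = Eψ` (with potential `V`) at every site of `S`. -/
def EigOn (V : ℤ × ℤ → ℝ) (E : ℝ) (ψ : ℤ × ℤ → ℝ) (S : Set (ℤ × ℤ)) : Prop :=
  ∀ n ∈ S, (4 + V n) * ψ n - ψ (n.1 + 1, n.2) - ψ (n.1 - 1, n.2)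
      - ψ (n.1, n.2 + 1) - ψ (n.1, n.2 - 1) = E * ψ n

/-- The tilted rectangle `{n : a₁ ≤ s(n) ≤ a₂, b₁ ≤ t(n) ≤ b₂}` in the tilted
coordinates `s = x + y`, `t = x − y`. -/
def tRect (a₁ a₂ b₁ b₂ : ℤ) : Set (ℤ × ℤ) :=
  {n | a₁ ≤ n.1 + n.2 ∧ n.1 + n.2 ≤ a₂ ∧ b₁ ≤ n.1 - n.2 ∧ n.1 - n.2 ≤ b₂}

/-- The tilted rectangle as a finite set. -/
def tRectF (a₁ a₂ b₁ b₂ : ℤ) : Finset (ℤ × ℤ) :=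
  ((Finset.Icc (-(|a₁| + |a₂| + |b₁| + |b₂|)) (|a₁| + |a₂| + |b₁| + |b₂|)) ×ˢ
    (Finset.Icc (-(|a₁| + |a₂| + |b₁| + |b₂|)) (|a₁| + |a₂| + |b₁| + |b₂|))).filter
    (fun n => a₁ ≤ n.1 + n.2 ∧ n.1 + n.2 ≤ a₂ ∧ b₁ ≤ n.1 - n.2 ∧ n.1 - n.2 ≤ b₂)

/-- `F` is `ε`-sparse in `R`: along every diagonal (in either tilted direction),
`F` occupies at most an `ε` fraction of `R`. -/
def SparseIn (ε : ℝ) (F R : Set (ℤ × ℤ)) : Prop :=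
  ∀ k : ℤ,
    ((F ∩ R ∩ {n | n.1 + n.2 = k}).ncard : ℝ) ≤ ε * ((R ∩ {n | n.1 + n.2 = k}).ncard : ℝ) ∧
    ((F ∩ R ∩ {n | n.1 - n.2 = k}).ncard : ℝ) ≤ ε * ((R ∩ {n | n.1 - n.2 = k}).ncard : ℝ)

/-- A tilted square: a tilted rectangle with equal side lengths. -/
def IsTiltedSquare (Q : Set (ℤ × ℤ)) : Prop :=
  ∃ (c d : ℤ) (a : ℕ), 0 < a ∧ Q = tRect c (c + a - 1) d (d + a - 1)

/-- `F` is `ε`-regular in `Λ`: any finite disjoint collection of tilted squares inside `Λ`,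
in none of which `F` is `ε`-sparse, covers at most an `ε` fraction of `Λ`. -/
def RegularIn (ε : ℝ) (F : Set (ℤ × ℤ)) (Λ : Set (ℤ × ℤ)) : Prop :=
  ∀ (m : ℕ) (Q : Fin m → Set (ℤ × ℤ)),
    (∀ i, IsTiltedSquare (Q i)) → (∀ i, Q i ⊆ Λ) →
    Pairwise (Function.onFun Disjoint Q) →
    (∀ i, ¬ SparseIn ε F (Q i)) →
    ((⋃ i, Q i).ncard : ℝ) ≤ ε * (Λ.ncard : ℝ)

/-- The lattice points of the axis-parallel square concentric with the square
`sqZ a b L` whose area is `c` times that of `sqZ a b L`. -/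
def scaledSq (a b : ℤ) (L : ℕ) (c : ℝ) : Set (ℤ × ℤ) :=
  {n | |(n.1 : ℝ) - ((a : ℝ) + ((L : ℝ) - 1) / 2)| ≤ Real.sqrt c * L / 2 ∧
       |(n.2 : ℝ) - ((b : ℝ) + ((L : ℝ) - 1) / 2)| ≤ Real.sqrt c * L / 2}

/-- The lattice points of the tilted square concentric with the tilted square
`tRect c (c+a−1) d (d+a−1)` whose area is `r` times as large. -/
def scaledTSq (c d : ℤ) (a : ℕ) (r : ℝ) : Set (ℤ × ℤ) :=
  {n | |((n.1 + n.2 : ℤ) : ℝ) - ((c : ℝ) + ((a : ℝ) - 1) / 2)| ≤ Real.sqrt r * a / 2 ∧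
       |((n.1 - n.2 : ℤ) : ℝ) - ((d : ℝ) + ((a : ℝ) - 1) / 2)| ≤ Real.sqrt r * a / 2}

/-- The scaled tilted square as a finite set. -/
def scaledTSqF (c d : ℤ) (a : ℕ) (r : ℝ) : Finset (ℤ × ℤ) :=
  (tRectF (c - ⌈Real.sqrt r * a⌉ - a) (c + a + ⌈Real.sqrt r * a⌉)
      (d - ⌈Real.sqrt r * a⌉ - a) (d + a + ⌈Real.sqrt r * a⌉)).filter
    (fun n => n ∈ scaledTSq c d a r)

/-- The boundary of `Λ'` inside `Λ`: pairs `(u,v)` with `u ∈ Λ'`, `v ∈ Λ \ Λ'`,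
`‖u − v‖₁ = 1`. -/
def bdry (Λ Λ' : Finset (ℤ × ℤ)) : Finset ((ℤ × ℤ) × (ℤ × ℤ)) :=
  (Λ' ×ˢ (Λ \ Λ')).filter
    (fun uv => (uv.1.1 - uv.2.1).natAbs + (uv.1.2 - uv.2.2).natAbs = 1)

/-- The defect at `(i + 1, j + 1)` of the eigenvalue equation in tilted coordinates, where `g` stands
for `4 + V - E`. -/
def tiltDefect (g u : ℕ → ℕ → ℝ) (i j : ℕ) : ℝ :=
  u (i + 2) (j + 2) + u i (j + 2) + u (i + 2) j + u i j - g (i + 1) (j + 1) * u (i + 1) (j + 1)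

/-- A function on a tilted rectangle is controlled by its values on two adjacent sides, with
polynomial loss in the length for every row. -/
lemma abs_le_of_tiltDefect_le {K η D : ℝ} {a b p : ℕ} {g u : ℕ → ℕ → ℝ} (hK : 0 ≤ K)
    (hg : ∀ i j, |g i j| ≤ K) (hη : 0 ≤ η) (hD : K + 4 ≤ D) (ha : 1 ≤ a)
    (h0 : ∀ i < a, ∀ j < 2, (i + j + p) % 2 = 0 → |u i j| ≤ η)
    (hl : ∀ i < 2, ∀ j < b, (i + j + p) % 2 = 0 → |u i j| ≤ η)
    (hr : ∀ i j, i + 2 < a → j + 2 < b → (i + j + p) % 2 = 0 → |tiltDefect g u i j| ≤ η) :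
    ∀ j < b, ∀ i < a, (i + j + p) % 2 = 0 → |u i j| ≤ η * (D * a) ^ j := by
  have ha' : (1 : ℝ) ≤ a := by exact_mod_cast ha
  have hDa : 1 ≤ D * a := by nlinarith
  have hη1 : ∀ j : ℕ, η ≤ η * (D * a) ^ j := fun j =>
    le_mul_of_one_le_right hη (one_le_pow₀ hDa)
  intro j
  induction j using Nat.strong_induction_on with
  | _ j ih =>
    intro hjb i hia hpar
    by_cases hj2 : j < 2
    · exact (h0 i hia j hj2 hpar).trans (hη1 j)
    obtain ⟨j, rfl⟩ : ∃ j', j = j' + 2 := ⟨j - 2, by omega⟩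
    set Bd := η * (D * a) ^ (j + 1) with hBd
    have hηB : η ≤ Bd := hη1 (j + 1)
    have hB : ∀ i' < a, (i' + j + p) % 2 = 0 → |u i' j| ≤ Bd := fun i' hi' hp' =>
      (ih j (by omega) (by omega) i' hi' hp').trans
        (mul_le_mul_of_nonneg_left (pow_le_pow_right₀ hDa (by omega)) hη)
    have hB1 : ∀ i' < a, (i' + (j + 1) + p) % 2 = 0 → |u i' (j + 1)| ≤ Bd := fun i' hi' hp' =>
      ih (j + 1) (by omega) (by omega) i' hi' hp'
    have key : ∀ i, i < a → (i + (j + 2) + p) % 2 = 0 →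
        |u i (j + 2)| ≤ η + i * ((K + 3) * Bd) := by
      intro i
      induction i using Nat.strong_induction_on with
      | _ i ihi =>
        intro hi hp
        by_cases hi2 : i < 2
        · refine (hl i hi2 (j + 2) hjb hp).trans ?_
          have : 0 ≤ (i : ℝ) * ((K + 3) * Bd) := by positivity
          linarith
        obtain ⟨i, rfl⟩ : ∃ i', i = i' + 2 := ⟨i - 2, by omega⟩
        have e1 := ihi i (by omega) (by omega) (by omega)
        have e2 := hB (i + 2) hi (by omega)
        have e3 := hB i (by omega) (by omega)
        have e4 := hB1 (i + 1) (by omega) (by omega)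
        have e5 := hr i j hi hjb (by omega)
        have e6 : |g (i + 1) (j + 1) * u (i + 1) (j + 1)| ≤ K * Bd := by
          rw [abs_mul]
          exact mul_le_mul (hg _ _) e4 (abs_nonneg _) hK
        have e7 : u (i + 2) (j + 2) = tiltDefect g u i j - u i (j + 2) - u (i + 2) j - u i j
            + g (i + 1) (j + 1) * u (i + 1) (j + 1) := by
          unfold tiltDefect; ring
        rw [e7]
        push_cast
        have hKB : 0 ≤ (K + 3) * Bd := by positivity
        rw [abs_le] at *
        constructor <;> nlinarith
    have := key i hia hpar
    have hi' : (i : ℝ) ≤ a := by exact_mod_cast hia.le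
    have hB0 : 0 ≤ Bd := hη.trans hηB
    have h1 : (i : ℝ) * ((K + 3) * Bd) ≤ a * ((K + 3) * Bd) := by gcongr
    have h2 : η * (D * a) ^ (j + 2) = D * a * Bd := by rw [hBd]; ring
    rw [h2]
    have h3 : Bd ≤ a * Bd := le_mul_of_one_le_left hB0 ha'
    have h4 : (K + 4) * (a * Bd) ≤ D * (a * Bd) := by gcongr
    nlinarith

/-- The solution of the tilted equation with value `w j` on the two left columns and zero on the
two lower rows. -/
def tiltSol (g : ℕ → ℕ → ℝ) (w : ℕ → ℝ) : ℕ → ℕ → ℝ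
  | 0, j => w j
  | 1, j => w j
  | _ + 2, 0 => 0
  | _ + 2, 1 => 0
  | i + 2, j + 2 => g (i + 1) (j + 1) * tiltSol g w (i + 1) (j + 1) - tiltSol g w i (j + 2)
      - tiltSol g w (i + 2) j - tiltSol g w i j
termination_by i j => i + j

lemma tiltDefect_tiltSol (g : ℕ → ℕ → ℝ) (w : ℕ → ℝ) (i j : ℕ) :
    tiltDefect g (tiltSol g w) i j = 0 := by
  unfold tiltDefect
  rw [tiltSol.eq_5]; ring

lemma tiltSol_left (g : ℕ → ℕ → ℝ) (w : ℕ → ℝ) {i : ℕ} (hi : i < 2) (j : ℕ) :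
    tiltSol g w i j = w j := by
  interval_cases i <;> simp [tiltSol]

lemma tiltSol_bottom (g : ℕ → ℕ → ℝ) {w : ℕ → ℝ} (hw : ∀ j < 2, w j = 0) (i : ℕ) {j : ℕ}
    (hj : j < 2) : tiltSol g w i j = 0 := by
  by_cases hi : i < 2
  · rw [tiltSol_left g w hi, hw j hj]
  obtain ⟨i, rfl⟩ : ∃ i', i = i' + 2 := ⟨i - 2, by omega⟩
  interval_cases j <;> simp [tiltSol]

lemma tiltSol_congr {g g' : ℕ → ℕ → ℝ} (w : ℕ → ℝ) :
    ∀ N i j, i + j < N → (∀ i' < i, ∀ j' < j, g i' j' = g' i' j') →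
      tiltSol g w i j = tiltSol g' w i j := by
  intro N
  induction N with
  | zero => intro i j h; omega
  | succ N ih =>
    intro i j hN h
    by_cases hi : i < 2
    · rw [tiltSol_left g w hi, tiltSol_left g' w hi]
    obtain ⟨i, rfl⟩ : ∃ i', i = i' + 2 := ⟨i - 2, by omega⟩
    by_cases hj : j < 2
    · interval_cases j <;> simp [tiltSol]
    obtain ⟨j, rfl⟩ : ∃ j', j = j' + 2 := ⟨j - 2, by omega⟩
    rw [tiltSol.eq_5, tiltSol.eq_5, h (i + 1) (by omega) (j + 1) (by omega),
      ih (i + 1) (j + 1) (by omega) fun i' hi' j' hj' => h i' (by omega) j' (by omega),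
      ih i (j + 2) (by omega) fun i' hi' j' hj' => h i' (by omega) j' (by omega),
      ih (i + 2) j (by omega) fun i' hi' j' hj' => h i' (by omega) j' (by omega),
      ih i j (by omega) fun i' hi' j' hj' => h i' (by omega) j' (by omega)]

lemma continuous_tiltSol {X : Type*} [TopologicalSpace X] {g : X → ℕ → ℕ → ℝ}
    (hg : ∀ i j, Continuous fun x => g x i j) (w : ℕ → ℝ) :
    ∀ N i j, i + j < N → Continuous fun x => tiltSol (g x) w i j := by
  intro N
  induction N with
  | zero => intro i j h; omega
  | succ N ih =>
    intro i j hN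
    by_cases hi : i < 2
    · simp only [tiltSol_left _ w hi]; exact continuous_const
    obtain ⟨i, rfl⟩ : ∃ i', i = i' + 2 := ⟨i - 2, by omega⟩
    by_cases hj : j < 2
    · interval_cases j <;> simp only [tiltSol] <;> exact continuous_const
    obtain ⟨j, rfl⟩ : ∃ j', j = j' + 2 := ⟨j - 2, by omega⟩
    simp only [tiltSol.eq_5]
    exact ((((hg _ _).mul (ih _ _ (by omega))).sub (ih _ _ (by omega))).sub
      (ih _ _ (by omega))).sub (ih _ _ (by omega))

/-- Changing the coefficient at the single site `(i + 1, j + 1)` changes the solution in the next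
column by an alternating multiple of its value at that site. -/
lemma tiltSol_perturb {g g' : ℕ → ℕ → ℝ} (w : ℕ → ℝ) {i j : ℕ}
    (h : ∀ i' j', (i', j') ≠ (i + 1, j + 1) → g' i' j' = g i' j') (n : ℕ) :
    tiltSol g' w (i + 2) (j + 2 + 2 * n) = tiltSol g w (i + 2) (j + 2 + 2 * n)
      + (-1) ^ n * (g' (i + 1) (j + 1) - g (i + 1) (j + 1)) * tiltSol g w (i + 1) (j + 1) := by
  have col : ∀ i' ≤ i + 1, ∀ j', tiltSol g' w i' j' = tiltSol g w i' j' := fun i' hi' j' =>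
    tiltSol_congr w _ i' j' (Nat.lt_succ_self _) fun i'' hi'' j'' _ =>
      h i'' j'' (by simp only [ne_eq, Prod.mk.injEq]; omega)
  induction n with
  | zero =>
    have hlow : tiltSol g' w (i + 2) j = tiltSol g w (i + 2) j :=
      tiltSol_congr w _ _ _ (Nat.lt_succ_self _) fun i'' _ j'' hj'' =>
        h i'' j'' (by simp only [ne_eq, Prod.mk.injEq]; omega)
    simp only [mul_zero, add_zero, pow_zero, one_mul]
    rw [tiltSol.eq_5, tiltSol.eq_5, hlow, col i (by omega), col i (by omega),
      col (i + 1) (by omega)]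
    ring
  | succ n ih =>
    have e : j + 2 + 2 * (n + 1) = (j + 2 + 2 * n) + 2 := by ring
    rw [e, tiltSol.eq_5, tiltSol.eq_5 g, ih, col i (by omega), col i (by omega),
      col (i + 1) (by omega),
      h (i + 1) (j + 2 + 2 * n + 1) (by simp only [ne_eq, Prod.mk.injEq]; omega)]
    ring

/-- A solution vanishing on the two lower rows whose left data are not small has a row in which all
its values are bounded below. -/
lemma exists_row_le_abs {K D : ℝ} {a b p : ℕ} {g u : ℕ → ℕ → ℝ} (hK : 0 ≤ K)
    (hg : ∀ i j, |g i j| ≤ K) (hD : 4 * (K + 4) ≤ D) (ha : 2 ≤ a)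
    (h0 : ∀ i < a, ∀ j < 2, u i j = 0)
    (hr : ∀ i j, tiltDefect g u i j = 0)
    (hl : ∃ i < 2, ∃ j < b, (i + j + p) % 2 = 0 ∧ 1 ≤ |u i j|) :
    ∃ j, 2 ≤ j ∧ j < b ∧ ∀ i < a, (i + j + p) % 2 = 0 → 1 / (D * a) ^ b ≤ |u i j| := by
  have ha' : (2 : ℝ) ≤ a := by exact_mod_cast ha
  set Q := 2 * (K + 2) * a with hQ
  have hQ1 : 1 ≤ Q := by nlinarith
  have hQ0 : 0 < Q := by linarith
  set P : ℕ → Prop := fun j => j < b ∧ ∃ i < a, (i + j + p) % 2 = 0 ∧ 1 / Q ^ (b - j) ≤ |u i j|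
  have hex : ∃ j, P j := by
    obtain ⟨i, hi, j, hj, hp, hu⟩ := hl
    refine ⟨j, hj, i, by omega, hp, le_trans ?_ hu⟩
    rw [div_le_one (by positivity)]
    exact one_le_pow₀ hQ1
  obtain ⟨hjb, i₀, hi₀, hp₀, hu₀⟩ := Nat.find_spec hex
  have hmin : ∀ j' < Nat.find hex, ∀ i < a, (i + j' + p) % 2 = 0 → |u i j'| < 1 / Q ^ (b - j') := by
    intro j' hj' i hi hp
    by_contra hcon
    exact Nat.find_min hex hj' ⟨by omega, i, hi, hp, not_lt.mp hcon⟩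
  set j := Nat.find hex with hj
  have hj2 : 2 ≤ j := by
    by_contra hcon
    rw [h0 i₀ hi₀ j (by omega), abs_zero] at hu₀
    have : 0 < 1 / Q ^ (b - j) := by positivity
    linarith
  obtain ⟨k, hk⟩ : ∃ k, j = k + 2 := ⟨j - 2, by omega⟩
  rw [hk] at hjb hp₀ hu₀ hmin
  clear_value j
  subst hk
  set δ := 1 / Q ^ (b - (k + 2)) with hδ
  have hδ0 : 0 < δ := by positivity
  have hlow : 1 / Q ^ (b - (k + 1)) = δ / Q := by
    rw [hδ, show b - (k + 1) = (b - (k + 2)) + 1 by omega, pow_succ]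
    field_simp
  have hlow' : 1 / Q ^ (b - k) ≤ δ / Q := by
    rw [← hlow]
    exact one_div_le_one_div_of_le (by positivity) (pow_le_pow_right₀ hQ1 (by omega))
  have step : ∀ i, i + 2 < a → (i + k + p) % 2 = 0 →
      |u (i + 2) (k + 2) + u i (k + 2)| ≤ (K + 2) * (δ / Q) := by
    intro i hi hp
    have e := hr i k
    have e1 := hmin k (by omega) (i + 2) hi (by omega)
    have e2 := hmin k (by omega) i (by omega) (by omega)
    have e3 := hmin (k + 1) (by omega) (i + 1) (by omega) (by omega)
    have e4 : |g (i + 1) (k + 1) * u (i + 1) (k + 1)| ≤ K * (δ / Q) := by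
      rw [abs_mul]
      exact mul_le_mul (hg _ _) (by linarith) (abs_nonneg _) hK
    have e5 : u (i + 2) (k + 2) + u i (k + 2)
        = g (i + 1) (k + 1) * u (i + 1) (k + 1) - u (i + 2) k - u i k := by
      unfold tiltDefect at e; linarith
    rw [e5]
    rw [abs_lt] at e1 e2
    rw [abs_le] at e4 ⊢
    constructor <;> linarith
  have hη0 : 0 ≤ (K + 2) * (δ / Q) := by positivity
  have walk : ∀ n i, i + 2 * n < a → (i + k + p) % 2 = 0 →
      |(|u (i + 2 * n) (k + 2)| - |u i (k + 2)|)| ≤ n * ((K + 2) * (δ / Q)) := by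
    intro n
    induction n with
    | zero => intro i _ _; simp
    | succ n ih =>
      intro i hi hp
      have e1 := ih i (by omega) hp
      have e2 := step (i + 2 * n) (by omega) (by omega)
      have e3 : |(|u (i + 2 * n + 2) (k + 2)| - |u (i + 2 * n) (k + 2)|)|
          ≤ (K + 2) * (δ / Q) := by
        refine le_trans ?_ e2
        have := abs_abs_sub_abs_le (u (i + 2 * n + 2) (k + 2)) (-u (i + 2 * n) (k + 2))
        rwa [abs_neg, sub_neg_eq_add] at this
      rw [show i + 2 * (n + 1) = i + 2 * n + 2 by ring]
      push_cast
      rw [abs_le] at *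
      constructor <;> linarith
  refine ⟨k + 2, hj2, hjb, fun i hi hp => ?_⟩
  have hdist : δ - a * ((K + 2) * (δ / Q)) ≤ |u i (k + 2)| := by
    rcases le_total i i₀ with hle | hle
    · obtain ⟨n, hn⟩ : ∃ n, i₀ = i + 2 * n := ⟨(i₀ - i) / 2, by omega⟩
      have e := walk n i (by omega) (by omega)
      rw [← hn] at e
      have hna : (n : ℝ) ≤ a := by exact_mod_cast (by omega : n ≤ a)
      have := mul_le_mul_of_nonneg_right hna hη0
      rw [abs_le] at e
      linarith
    · obtain ⟨n, hn⟩ : ∃ n, i = i₀ + 2 * n := ⟨(i - i₀) / 2, by omega⟩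
      have e := walk n i₀ (by omega) (by omega)
      rw [← hn] at e
      have hna : (n : ℝ) ≤ a := by exact_mod_cast (by omega : n ≤ a)
      have := mul_le_mul_of_nonneg_right hna hη0
      rw [abs_le] at e
      linarith
  have hhalf : a * ((K + 2) * (δ / Q)) = δ / 2 := by
    rw [hQ]; field_simp
  refine le_trans ?_ hdist
  rw [hhalf]
  have h1 : 1 / (D * a) ^ b ≤ 1 / (2 * Q ^ b) := by
    apply one_div_le_one_div_of_le (by positivity)
    have : 2 * Q ^ b ≤ 2 ^ b * Q ^ b := by
      gcongr
      exact le_self_pow₀ (by norm_num) (by omega)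
    refine this.trans ?_
    rw [← mul_pow]
    apply pow_le_pow_left₀ (by positivity)
    rw [hQ]
    nlinarith
  have h2 : 1 / Q ^ b ≤ δ :=
    one_div_le_one_div_of_le (by positivity) (pow_le_pow_right₀ hQ1 (by omega))
  have h3 : 1 / (2 * Q ^ b) = (1 / Q ^ b) / 2 := by field_simp
  linarith

open scoped ENNReal in
/-- The integral of a product of factors, each of which has small integral in its own coordinate and
does not depend on the coordinates of the later ones. -/
lemma lintegral_prod_le_pow {ι : Type*} [Fintype ι] (μ : ι → Measure ℝ)
    [∀ i, IsProbabilityMeasure (μ i)] (k : ℕ → ι) (f : ℕ → (ι → ℝ) → ℝ≥0∞) (θ : ℝ≥0∞)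
    (hf : ∀ i, Measurable (f i)) (S : Finset ℕ)
    (hdep : ∀ i ∈ S, ∀ l ∈ S, i < l → ∀ ω x, f i (Function.update ω (k l) x) = f i ω)
    (hθ : ∀ i ∈ S, ∀ ω, ∫⁻ x, f i (Function.update ω (k i) x) ∂μ (k i) ≤ θ) :
    ∫⁻ ω, ∏ i ∈ S, f i ω ∂(Measure.pi μ) ≤ θ ^ S.card := by
  induction S using Finset.induction_on_max with
  | empty => simp
  | insert m S hm ih =>
    have hmS : m ∉ S := fun h => lt_irrefl _ (hm m h)
    have ih' := ih (fun i hi l hl => hdep i (Finset.mem_insert_of_mem hi) l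
      (Finset.mem_insert_of_mem hl)) (fun i hi => hθ i (Finset.mem_insert_of_mem hi))
    rw [Finset.card_insert_of_notMem hmS, pow_succ']
    have hprod : Measurable fun ω => ∏ i ∈ S, f i ω := Finset.measurable_prod _ fun i _ => hf i
    calc ∫⁻ ω, ∏ i ∈ insert m S, f i ω ∂(Measure.pi μ)
        ≤ ∫⁻ ω, θ * ∏ i ∈ S, f i ω ∂(Measure.pi μ) := by
          refine lintegral_le_of_lmarginal_le {k m}
            (Finset.measurable_prod _ fun i _ => hf i) (hprod.const_mul θ) fun ω => ?_
          rw [lmarginal_singleton, lmarginal_singleton]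
          have e : ∀ x, ∏ i ∈ S, f i (Function.update ω (k m) x) = ∏ i ∈ S, f i ω := fun x =>
            Finset.prod_congr rfl fun i hi => hdep i (Finset.mem_insert_of_mem hi) m
              (Finset.mem_insert_self _ _) (hm i hi) ω x
          simp only [Finset.prod_insert hmS, e]
          have hm' : Measurable fun x => f m (Function.update ω (k m) x) :=
            (hf m).comp (measurable_update ω)
          rw [lintegral_mul_const _ hm', lintegral_const, measure_univ, mul_one]
          exact mul_le_mul_left (hθ m (Finset.mem_insert_self _ _) ω) _
      _ = θ * ∫⁻ ω, ∏ i ∈ S, f i ω ∂(Measure.pi μ) := lintegral_const_mul _ hprod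
      _ ≤ θ * θ ^ S.card := mul_le_mul_right ih' _

/-- Anticoncentration around points of `[0, M]` for a measure carried by `[0, M]` extends to all
centres. -/
lemma measure_abs_sub_le {M γ₀ ρ : ℝ} (hM : 0 ≤ M) {ν : Measure ℝ} [IsProbabilityMeasure ν]
    (hsupp : ν (Set.Icc 0 M) = 1)
    (hac : ∀ t ∈ Set.Icc (0 : ℝ) M, ENNReal.ofReal ρ ≤ ν {s | γ₀ / 2 < |s - t|}) (t : ℝ) :
    ν {s | |s - t| ≤ γ₀ / 2} ≤ 1 - ENNReal.ofReal ρ := by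
  set t' := max 0 (min M t) with ht'
  have ht'm : t' ∈ Set.Icc (0 : ℝ) M := ⟨le_max_left _ _, max_le hM (min_le_left _ _)⟩
  have hcl : ∀ s ∈ Set.Icc (0 : ℝ) M, |s - t'| ≤ |s - t| := by
    rintro s ⟨h0, h1⟩
    rw [ht']
    rcases le_total M t with h | h
    · rw [min_eq_left h, max_eq_right hM, abs_of_nonpos (by linarith), abs_of_nonpos (by linarith)]
      linarith
    · rw [min_eq_right h]
      rcases le_total 0 t with h' | h'
      · rw [max_eq_right h']
      · rw [max_eq_left h', abs_of_nonneg (by linarith), abs_of_nonneg (by linarith)]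
        linarith
  have hms : MeasurableSet {s : ℝ | γ₀ / 2 < |s - t'|} :=
    measurableSet_lt measurable_const (by fun_prop)
  have hnull : ν (Set.Icc 0 M)ᶜ = 0 := by
    rw [prob_compl_eq_zero_iff measurableSet_Icc, hsupp]
  calc ν {s | |s - t| ≤ γ₀ / 2}
      ≤ ν ({s | γ₀ / 2 < |s - t'|}ᶜ ∪ (Set.Icc 0 M)ᶜ) := by
        apply measure_mono
        intro s hs
        by_cases hsM : s ∈ Set.Icc (0 : ℝ) M
        · left
          simp only [Set.mem_compl_iff, Set.mem_ofPred_eq, not_lt] at hs ⊢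
          exact (hcl s hsM).trans hs
        · right; exact hsM
    _ ≤ ν {s | γ₀ / 2 < |s - t'|}ᶜ + ν (Set.Icc 0 M)ᶜ := measure_union_le _ _
    _ = 1 - ν {s | γ₀ / 2 < |s - t'|} := by rw [hnull, add_zero, prob_compl_eq_one_sub hms]
    _ ≤ 1 - ENNReal.ofReal ρ := tsub_le_tsub_left (hac t' ht'm) _

/-- The potential on a chart: a coordinate of `ω` at free sites, a frozen value elsewhere. -/
def chartPot {ι : Type*} (κ : ℕ → ℕ → Option ι) (q : ℕ → ℕ → ℝ) (ω : ι → ℝ) (i j : ℕ) : ℝ :=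
  (κ i j).elim (q i j) ω

lemma continuous_chartPot {ι : Type*} (κ : ℕ → ℕ → Option ι) (q : ℕ → ℕ → ℝ) (i j : ℕ) :
    Continuous fun ω => chartPot κ q ω i j := by
  unfold chartPot
  cases κ i j with
  | none => exact continuous_const
  | some k => exact continuous_apply k

lemma chartPot_update_of_ne {ι : Type*} {κ : ℕ → ℕ → Option ι} (q : ℕ → ℕ → ℝ)
    (hκ : ∀ i j i' j' k, κ i j = some k → κ i' j' = some k → i = i' ∧ j = j')
    {i j i' j' : ℕ} {k : ι} (hk : κ i j = some k) (hne : (i', j') ≠ (i, j)) (ω : ι → ℝ) (x : ℝ) :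
    chartPot κ q (Function.update ω k x) i' j' = chartPot κ q ω i' j' := by
  unfold chartPot
  cases h : κ i' j' with
  | none => rfl
  | some k' =>
    have : k' ≠ k := by
      rintro rfl
      obtain ⟨rfl, rfl⟩ := hκ _ _ _ _ _ h hk
      exact hne rfl
    simp [Function.update_of_ne this]

open scoped ENNReal in
/-- It is unlikely that a row bounded below at the free sites of a set of columns leaves only few
large values in a row above it. -/
lemma measure_few_large_le {ι : Type*} [Fintype ι] (μ : ι → Measure ℝ)
    [∀ i, IsProbabilityMeasure (μ i)] {γ₀ : ℝ} {θ : ℝ≥0∞}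
    (hac : ∀ (k : ι) (t : ℝ), μ k {s | |s - t| ≤ γ₀ / 2} ≤ θ)
    {κ : ℕ → ℕ → Option ι} (q : ℕ → ℕ → ℝ)
    (hκ : ∀ i j i' j' k, κ i j = some k → κ i' j' = some k → i = i' ∧ j = j')
    (Eb : ℝ) (w : ℕ → ℝ) (j n a p c : ℕ) {δ δ' : ℝ} (hδ : 0 < δ) (hδ' : 2 * δ' / δ ≤ γ₀ / 2)
    (S : Finset ℕ)
    (hS : ∀ i ∈ S, i + 2 < a ∧ (i + 1 + (j + 1) + p) % 2 = 0 ∧ κ (i + 1) (j + 1) ≠ none) :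
    Measure.pi μ {ω | (∀ i ∈ S, δ ≤ |tiltSol (fun i j => 4 + chartPot κ q ω i j - Eb) w
          (i + 1) (j + 1)|) ∧
        ((Finset.range a).filter fun i => (i + (j + 2 + 2 * n) + p) % 2 = 0 ∧
          δ' < |tiltSol (fun i j => 4 + chartPot κ q ω i j - Eb) w i (j + 2 + 2 * n)|).card ≤ c}
      ≤ 2 ^ (2 * c) * (2⁻¹ + 2⁻¹ * θ) ^ S.card := by
  rcases S.eq_empty_or_nonempty with rfl | ⟨i₀, hi₀⟩
  · simp only [Finset.card_empty, pow_zero, mul_one]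
    exact prob_le_one.trans (one_le_pow₀ (by norm_num))
  have : Nonempty ι := (Option.ne_none_iff_exists'.mp (hS i₀ hi₀).2.2).nonempty
  choose! k hk using fun i (hi : i ∈ S) => Option.ne_none_iff_exists'.mp (hS i hi).2.2
  set u : (ι → ℝ) → ℕ → ℕ → ℝ :=
    fun ω => tiltSol (fun i j => 4 + chartPot κ q ω i j - Eb) w with hu
  have hcont : ∀ i j, Continuous fun ω => u ω i j := fun i j =>
    continuous_tiltSol (fun i j => (continuous_const.add (continuous_chartPot κ q i j)).sub
      continuous_const) w _ i j (Nat.lt_succ_self _)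
  set T := j + 2 + 2 * n with hT
  set R : ℕ → Set (ι → ℝ) := fun i => {ω | δ ≤ |u ω (i + 1) (j + 1)|} with hR
  set A : ℕ → Set (ι → ℝ) := fun i => {ω | |u ω i T| ≤ δ'} ∩ {ω | |u ω (i + 2) T| ≤ δ'} with hA
  have hRm : ∀ i, MeasurableSet (R i) := fun i =>
    measurableSet_le measurable_const (hcont _ _).measurable.abs
  have hAm : ∀ i, MeasurableSet (A i) := fun i =>
    (measurableSet_le (hcont _ _).measurable.abs measurable_const).inter
      (measurableSet_le (hcont _ _).measurable.abs measurable_const)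
  set f : ℕ → (ι → ℝ) → ℝ≥0∞ := fun i ω =>
    (R i).indicator (fun ω => 2⁻¹ + 2⁻¹ * (A i).indicator 1 ω) ω with hf
  have hfm : ∀ i, Measurable (f i) := fun i =>
    (measurable_const.add (((measurable_one.indicator (hAm i))).const_mul _)).indicator (hRm i)
  -- columns up to `l + 1` do not see the coordinate of column `l + 1`
  have hcol : ∀ l ∈ S, ∀ i ≤ l + 1, ∀ j' ω x, u (Function.update ω (k l) x) i j' = u ω i j' := by
    intro l hl i hi j' ω x
    refine tiltSol_congr w _ i j' (Nat.lt_succ_self _) fun i'' hi'' j'' _ => ?_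
    rw [chartPot_update_of_ne q hκ (hk l hl) (by simp only [ne_eq, Prod.mk.injEq]; omega)]
  have hdep : ∀ i ∈ S, ∀ l ∈ S, i < l → ∀ ω x, f i (Function.update ω (k l) x) = f i ω := by
    intro i _ l hl hil ω x
    simp only [hf, hR, hA, Set.indicator, Set.mem_ofPred_eq, Set.mem_inter_iff, Pi.one_apply,
      hcol l hl (i + 1) (by omega), hcol l hl i (by omega), hcol l hl (i + 2) (by omega)]
  have hθ : ∀ i ∈ S, ∀ ω, ∫⁻ x, f i (Function.update ω (k i) x) ∂μ (k i) ≤ 2⁻¹ + 2⁻¹ * θ := by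
    intro i hi ω
    by_cases hω : ω ∈ R i
    swap
    · have : ∀ x, f i (Function.update ω (k i) x) = 0 := by
        intro x
        apply Set.indicator_of_notMem
        simpa only [hR, Set.mem_ofPred_eq, hcol i hi (i + 1) le_rfl] using hω
      simp [this]
    set σ := u ω (i + 1) (j + 1) with hσ
    have hσδ : δ ≤ |σ| := hω
    have hσ0 : σ ≠ 0 := abs_pos.mp (hδ.trans_le hσδ)
    set t := ω (k i) - (-1) ^ n * (u ω (i + 2) T + u ω i T) / σ with ht
    have hsub : ∀ x, f i (Function.update ω (k i) x)
        ≤ 2⁻¹ + 2⁻¹ * ({s | |s - t| ≤ γ₀ / 2} : Set ℝ).indicator 1 x := by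
      intro x
      refine (Set.indicator_le_self _ _ _).trans ?_
      gcongr
      by_cases hx : Function.update ω (k i) x ∈ A i
      swap
      · rw [Set.indicator_of_notMem hx]; exact zero_le
      rw [Set.indicator_of_mem hx, Set.indicator_of_mem]
      · rfl
      obtain ⟨h1, h2⟩ := hx
      simp only [Set.mem_ofPred_eq] at h1 h2 ⊢
      rw [hcol i hi i (by omega)] at h1
      have hp := tiltSol_perturb (g := fun i' j' => 4 + chartPot κ q ω i' j' - Eb)
        (g' := fun i' j' => 4 + chartPot κ q (Function.update ω (k i) x) i' j' - Eb) w (i := i) (j := j)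
        (fun i' j' hne => by simp only [chartPot_update_of_ne q hκ (hk i hi) hne]) n
      have hp' : u (Function.update ω (k i) x) (i + 2) T
          = u ω (i + 2) T + (-1) ^ n * (x - ω (k i)) * σ := by
        refine hp.trans ?_
        rw [hσ, hu]
        simp only [chartPot, hk i hi, Option.elim_some, Function.update_self]
        ring
      rw [hp'] at h2
      have hsq : ((-1 : ℝ) ^ n) * (-1) ^ n = 1 := by
        rw [← mul_pow]; norm_num
      have e : x - t = (-1) ^ n * ((u ω (i + 2) T + (-1) ^ n * (x - ω (k i)) * σ) + u ω i T) / σ := by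
        rw [ht, eq_div_iff hσ0, sub_mul, sub_mul, div_mul_cancel₀ _ hσ0]
        linear_combination (-(x - ω (k i)) * σ) * hsq
      rw [e, abs_div, abs_mul, abs_pow, abs_neg, abs_one, one_pow, one_mul]
      refine le_trans ?_ hδ'
      have h3 := (abs_add_le (u ω (i + 2) T + (-1) ^ n * (x - ω (k i)) * σ) (u ω i T)).trans
        (add_le_add h2 h1)
      have h4 : 0 ≤ δ' := (abs_nonneg _).trans h1
      exact div_le_div₀ (by positivity) (by linarith) hδ hσδ
    have hms : MeasurableSet {s : ℝ | |s - t| ≤ γ₀ / 2} :=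
      measurableSet_le (by fun_prop) measurable_const
    calc ∫⁻ x, f i (Function.update ω (k i) x) ∂μ (k i)
        ≤ ∫⁻ x, (2⁻¹ + 2⁻¹ * ({s | |s - t| ≤ γ₀ / 2} : Set ℝ).indicator 1 x) ∂μ (k i) :=
          lintegral_mono hsub
      _ = 2⁻¹ + 2⁻¹ * μ (k i) {s | |s - t| ≤ γ₀ / 2} := by
          rw [lintegral_add_left measurable_const, lintegral_const, measure_univ, mul_one,
            lintegral_const_mul _ (measurable_one.indicator hms), lintegral_indicator_one hms]
      _ ≤ 2⁻¹ + 2⁻¹ * θ := by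
          gcongr
          exact hac _ _
  have hlintegral := lintegral_prod_le_pow μ k f _ hfm S hdep hθ
  have hmk := mul_meas_ge_le_lintegral (μ := Measure.pi μ)
    (Finset.measurable_prod S fun i _ => hfm i) ((2⁻¹ : ℝ≥0∞) ^ (2 * c))
  have hsubset : {ω | (∀ i ∈ S, δ ≤ |u ω (i + 1) (j + 1)|) ∧
        ((Finset.range a).filter fun i => (i + T + p) % 2 = 0 ∧ δ' < |u ω i T|).card ≤ c}
      ⊆ {ω | (2⁻¹ : ℝ≥0∞) ^ (2 * c) ≤ ∏ i ∈ S, f i ω} := by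
    rintro ω ⟨hω1, hω2⟩
    simp only [Set.mem_ofPred_eq]
    set Z := (Finset.range a).filter fun i => (i + T + p) % 2 = 0 ∧ δ' < |u ω i T| with hZ
    set Y := S.filter fun i => ω ∉ A i with hY
    have hYc : Y.card ≤ 2 * c := by
      have hYsub : Y ⊆ Z ∪ (S.filter fun i => i + 2 ∈ Z) := by
        intro i hi
        rw [hY, Finset.mem_filter] at hi
        have hSi := hS i hi.1
        simp only [Finset.mem_union, hZ, Finset.mem_filter, Finset.mem_range]
        by_contra hcon
        rw [not_or] at hcon
        apply hi.2
        constructor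
        · by_contra h'
          exact hcon.1 ⟨by omega, by omega, not_le.mp h'⟩
        · by_contra h'
          exact hcon.2 ⟨hi.1, by omega, by omega, not_le.mp h'⟩
      have h2 : (S.filter fun i => i + 2 ∈ Z).card ≤ Z.card :=
        Finset.card_le_card_of_injOn (fun i => i + 2) (fun i hi => (Finset.mem_filter.mp hi).2)
          (fun x _ y _ h => by simpa using h)
      calc Y.card ≤ _ := Finset.card_le_card hYsub
        _ ≤ _ := Finset.card_union_le _ _
        _ ≤ 2 * c := by omega
    have hfi : ∀ i ∈ S, (if ω ∉ A i then (2⁻¹ : ℝ≥0∞) else 1) ≤ f i ω := by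
      intro i hi
      have : ω ∈ R i := hω1 i hi
      simp only [hf, Set.indicator_of_mem this]
      by_cases h : ω ∈ A i
      · rw [if_neg (not_not.mpr h), Set.indicator_of_mem h, Pi.one_apply, mul_one,
          ENNReal.inv_two_add_inv_two]
      · rw [if_pos h]
        exact le_self_add
    calc (2⁻¹ : ℝ≥0∞) ^ (2 * c) ≤ 2⁻¹ ^ Y.card :=
          pow_le_pow_right_of_le_one' (by simp) hYc
      _ = ∏ i ∈ S, if ω ∉ A i then (2⁻¹ : ℝ≥0∞) else 1 := by
          rw [Finset.prod_ite, Finset.prod_const, Finset.prod_const_one, mul_one]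
      _ ≤ ∏ i ∈ S, f i ω := Finset.prod_le_prod' hfi
  refine (measure_mono hsubset).trans ?_
  have h1 : (2 : ℝ≥0∞) ^ (2 * c) * 2⁻¹ ^ (2 * c) = 1 := by
    rw [← mul_pow, ENNReal.mul_inv_cancel (by norm_num) (by norm_num), one_pow]
  calc _ = (2 : ℝ≥0∞) ^ (2 * c) * (2⁻¹ ^ (2 * c) *
        Measure.pi μ {ω | (2⁻¹ : ℝ≥0∞) ^ (2 * c) ≤ ∏ i ∈ S, f i ω}) := by
          rw [← mul_assoc, h1, one_mul]
    _ ≤ _ := mul_le_mul_right (hmk.trans hlintegral) _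

/-- On a strip with potential `V`, approximate eigenfunctions that are bounded by one on the two
bottom rows and at most sites of the two top rows are bounded throughout by `P ^ 4`. -/
def StripGood (a b p : ℕ) (P Eb c : ℝ) (V : ℕ → ℕ → ℝ) : Prop :=
  ∀ (E : ℝ) (u : ℕ → ℕ → ℝ), |E - Eb| ≤ 1 / P ^ 4 →
    (∀ i j, i + 2 < a → j + 2 < b → (i + j + p) % 2 = 0 →
      tiltDefect (fun i j => 4 + V i j - E) u i j = 0) →
    (∀ i < a, ∀ j < 2, (i + j + p) % 2 = 0 → |u i j| ≤ 1) →
    (∀ j < b, b ≤ j + 2 →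
      ((((Finset.range a).filter fun i => (i + j + p) % 2 = 0 ∧ 1 < |u i j|).card : ℕ) : ℝ)
        ≤ c * a) →
    ∀ i < a, ∀ j < b, (i + j + p) % 2 = 0 → |u i j| ≤ P ^ 4

lemma le_two_mul_card_filter_mod_two (a m : ℕ) :
    a ≤ 2 * ((Finset.range a).filter fun i => (i + m) % 2 = 0).card + 1 := by
  have : Finset.range (a / 2) ⊆ ((Finset.range a).filter fun i => (i + m) % 2 = 0).image (· / 2) := by
    intro i hi
    rw [Finset.mem_range] at hi
    rw [Finset.mem_image]
    refine ⟨2 * i + m % 2, ?_, by omega⟩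
    rw [Finset.mem_filter, Finset.mem_range]
    omega
  have h1 := (Finset.card_le_card this).trans Finset.card_image_le
  rw [Finset.card_range] at h1
  omega

/-- A solution violating the conclusion of `StripGood` can be replaced by one whose boundary values
lie on a finite grid. -/
lemma exists_grid_of_not_stripGood {M D Eb c P : ℝ} {a b p : ℕ} {V : ℕ → ℕ → ℝ}
    (hV : ∀ i j, V i j ∈ Set.Icc 0 M) (hEb : Eb ∈ Set.Icc 0 (8 + M))
    (hD : 4 * (M + 9) ≤ D) (ha : 16 ≤ a) (hb : 1 ≤ b) (hc : c ≤ 1 / 64) (hP : P = (D * a) ^ b)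
    (hbad : ¬ StripGood a b p P Eb c V) :
    ∃ w : Fin b → ℤ, (∀ k, |w k| ≤ ⌈P ^ 3⌉₊) ∧ ∃ j, 2 ≤ j ∧ j + 1 < b ∧
      (∀ i < a, (i + j + p) % 2 = 0 → 1 / P ≤ |tiltSol (fun i j => 4 + V i j - Eb)
        (fun j => if h : j < b then (w ⟨j, h⟩ : ℝ) / ⌈P ^ 3⌉₊ else 0) i j|) ∧
      ∀ j < b, b ≤ j + 2 →
        ((((Finset.range a).filter fun i => (i + j + p) % 2 = 0 ∧
          2 / P ^ 2 < |tiltSol (fun i j => 4 + V i j - Eb)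
            (fun j => if h : j < b then (w ⟨j, h⟩ : ℝ) / ⌈P ^ 3⌉₊ else 0) i j|).card : ℕ) : ℝ)
          ≤ c * a := by
  have hM : 0 ≤ M := (hV 0 0).1.trans (hV 0 0).2
  have haR : (16 : ℝ) ≤ a := by exact_mod_cast ha
  have hDa : 576 ≤ D * a := by nlinarith
  have hP1 : 576 ≤ P := by
    rw [hP]; exact hDa.trans (le_self_pow₀ (by linarith) (by omega))
  have hP0 : 0 < P := by linarith
  unfold StripGood at hbad
  push Not at hbad
  obtain ⟨E, u, hE, hr, h0, htop, i₀, hi₀, j₀, hj₀, hval₀, hbig⟩ := hbad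
  have hP4 : 1 ≤ P ^ 4 := one_le_pow₀ (by linarith)
  have hEE : |E - Eb| ≤ 1 := hE.trans (by rw [div_le_one (by positivity)]; exact hP4)
  have hgE : ∀ i j, |4 + V i j - E| ≤ M + 5 := by
    intro i j
    have h1 := (hV i j).1
    have h2 := (hV i j).2
    have h3 := hEb.1
    have h4 := hEb.2
    rw [abs_le] at hEE ⊢
    constructor <;> linarith
  have hgEb : ∀ i j, |4 + V i j - Eb| ≤ M + 5 := by
    intro i j
    have h1 := (hV i j).1
    have h2 := (hV i j).2
    have h3 := hEb.1
    have h4 := hEb.2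
    rw [abs_le]
    constructor <;> linarith
  have hpow : ∀ j < b, (D * a) ^ j ≤ P := fun j hj => by
    rw [hP]; exact pow_le_pow_right₀ (by linarith) hj.le
  obtain ⟨j₁, hj₁, hmax⟩ := Finset.exists_max_image (Finset.range b)
    (fun j => |u ((j + p) % 2) j|) ⟨0, Finset.mem_range.mpr hb⟩
  rw [Finset.mem_range] at hj₁
  set m := |u ((j₁ + p) % 2) j₁| with hm
  have hleft : ∀ i < 2, ∀ j < b, (i + j + p) % 2 = 0 → |u i j| ≤ m := by
    intro i hi j hj hv
    have : i = (j + p) % 2 := by omega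
    rw [this]
    exact hmax j (Finset.mem_range.mpr hj)
  have hgrow : ∀ j < b, ∀ i < a, (i + j + p) % 2 = 0 → |u i j| ≤ max m 1 * P := by
    intro j hj i hi hv
    refine (abs_le_of_tiltDefect_le (K := M + 5) (D := D) (g := fun i j => 4 + V i j - E)
      (η := max m 1) (by linarith) hgE
      (by positivity) (by linarith) (by omega)
      (fun i hi j hj hv => (h0 i hi j hj hv).trans (le_max_right _ _))
      (fun i hi j hj hv => (hleft i hi j hj hv).trans (le_max_left _ _))
      (fun i j hi hj hv => by rw [hr i j hi hj hv]; simp) j hj i hi hv).trans ?_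
    exact mul_le_mul_of_nonneg_left (hpow j hj) (by positivity)
  have hmP : P ^ 3 < m := by
    have h1 := hbig.trans_le (hgrow j₀ hj₀ i₀ hi₀ hval₀)
    have h2 : P ^ 3 < max m 1 := by
      rw [show P ^ 4 = P ^ 3 * P by ring] at h1
      exact lt_of_mul_lt_mul_right h1 hP0.le
    rcases lt_max_iff.mp h2 with h | h
    · exact h
    · exact absurd h (not_lt.mpr (one_le_pow₀ (by linarith)))
  have hP3 : 1 ≤ P ^ 3 := one_le_pow₀ (by linarith)
  have hm0 : 0 < m := by linarith
  have hmax1 : max m 1 = m := max_eq_left (by linarith)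
  have hj₁2 : 2 ≤ j₁ := by
    by_contra h
    have := h0 ((j₁ + p) % 2) (by omega) j₁ (by omega) (by omega)
    rw [← hm] at this
    linarith
  set N := ⌈P ^ 3⌉₊ with hN
  have hNP : P ^ 3 ≤ N := Nat.le_ceil _
  have hN0 : (0 : ℝ) < N := by linarith
  set w : Fin b → ℤ := fun k => if (k : ℕ) < 2 then 0 else round (N * (u ((k + p) % 2) k / m)) with hw
  set W : ℕ → ℝ := fun j => if h : j < b then (w ⟨j, h⟩ : ℝ) / N else 0 with hW
  have hW2 : ∀ j < 2, W j = 0 := by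
    intro j hj
    simp only [hW, hw, hj, if_true, Int.cast_zero, zero_div, dite_eq_ite, ite_self]
  have hratio : ∀ j < b, |u ((j + p) % 2) j / m| ≤ 1 := by
    intro j hj
    rw [abs_div, abs_of_pos hm0, div_le_one hm0]
    exact hmax j (Finset.mem_range.mpr hj)
  have hWj : ∀ j, 2 ≤ j → j < b → |u ((j + p) % 2) j / m - W j| ≤ 1 / P ^ 3 := by
    intro j h2 hj
    simp only [hW, hw, hj, dif_pos, not_lt.mpr h2, if_false]
    have h1 := abs_sub_round (N * (u ((j + p) % 2) j / m))
    set x := u ((j + p) % 2) j / m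
    have h3 : x - (round (N * x) : ℝ) / N = (N * x - round (N * x)) / N := by field_simp
    rw [h3, abs_div, abs_of_pos hN0]
    exact div_le_div₀ zero_le_one (by linarith) (by positivity) hNP
  set U := tiltSol (fun i j => 4 + V i j - Eb) W with hU
  have hUr : ∀ i j, tiltDefect (fun i j => 4 + V i j - Eb) U i j = 0 := tiltDefect_tiltSol _ _
  have hinv : 1 / m ≤ 1 / P ^ 3 := one_div_le_one_div_of_le (by positivity) hmP.le
  have hsmall : ∀ i j, |u i j| ≤ 1 → |u i j / m| ≤ 1 / P ^ 3 := by
    intro i j h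
    rw [abs_div, abs_of_pos hm0]
    exact (div_le_div_of_nonneg_right h hm0.le).trans hinv
  have hd : ∀ j < b, ∀ i < a, (i + j + p) % 2 = 0 → |u i j / m - U i j| ≤ 1 / P ^ 2 := by
    intro j hj i hi hv
    refine (abs_le_of_tiltDefect_le (K := M + 5) (D := D) (g := fun i j => 4 + V i j - Eb)
      (u := fun i j => u i j / m - U i j)
      (η := 1 / P ^ 3) (by linarith) hgEb (by positivity) (by linarith) (by omega : 1 ≤ a)
      (fun i hi j hj hv => ?_) (fun i hi j hj hv => ?_) (fun i j hi hj hv => ?_) j hj i hi hv).trans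
      ?_
    · simp only [hU]
      rw [tiltSol_bottom _ hW2 i hj, sub_zero]
      exact hsmall _ _ (h0 i hi j hj hv)
    · simp only [hU]
      rw [tiltSol_left _ _ hi]
      rcases lt_or_ge j 2 with h | h
      · rw [hW2 j h, sub_zero]
        exact hsmall _ _ (h0 i (by omega) j h hv)
      · have : i = (j + p) % 2 := by omega
        rw [this]
        exact hWj j h hj
    · have h1 := hr i j hi hj hv
      have h2 := hUr i j
      have h3 : tiltDefect (fun i j => 4 + V i j - Eb) (fun i j => u i j / m - U i j) i j
          = (Eb - E) * (u (i + 1) (j + 1) / m) := by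
        simp only [tiltDefect] at h1 h2 ⊢
        linear_combination h1 / m - h2
      rw [h3, abs_mul, abs_sub_comm]
      have h4 : |u (i + 1) (j + 1) / m| ≤ P := by
        rw [abs_div, abs_of_pos hm0, div_le_iff₀ hm0]
        have := hgrow (j + 1) (by omega) (i + 1) (by omega) (by omega)
        rw [hmax1] at this
        linarith
      calc |E - Eb| * |u (i + 1) (j + 1) / m| ≤ 1 / P ^ 4 * P :=
            mul_le_mul hE h4 (abs_nonneg _) (by positivity)
        _ = 1 / P ^ 3 := by field_simp
    · calc 1 / P ^ 3 * (D * a) ^ j ≤ 1 / P ^ 3 * P :=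
            mul_le_mul_of_nonneg_left (hpow j hj) (by positivity)
        _ = 1 / P ^ 2 := by field_simp
  have htopU : ∀ j < b, b ≤ j + 2 →
      ((((Finset.range a).filter fun i => (i + j + p) % 2 = 0 ∧ 2 / P ^ 2 < |U i j|).card : ℕ) : ℝ)
        ≤ c * a := by
    intro j hj hjb
    refine le_trans ?_ (htop j hj hjb)
    norm_cast
    apply Finset.card_le_card
    intro i hi
    rw [Finset.mem_filter, Finset.mem_range] at hi ⊢
    refine ⟨hi.1, hi.2.1, ?_⟩
    by_contra hcon
    have h1 := hsmall i j (not_lt.mp hcon)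
    have h2 := hd j hj i hi.1 hi.2.1
    have h3 : 1 / P ^ 3 ≤ 1 / P ^ 2 :=
      one_div_le_one_div_of_le (by positivity) (pow_le_pow_right₀ (by linarith) (by norm_num))
    have h4 : |U i j| ≤ |u i j / m| + |u i j / m - U i j| := by
      have := abs_sub (u i j / m) (u i j / m - U i j)
      rwa [sub_sub_cancel] at this
    have h5 : 2 / P ^ 2 = 1 / P ^ 2 + 1 / P ^ 2 := by ring
    linarith [hi.2.2]
  obtain ⟨j, hj2, hjb, hlow⟩ := exists_row_le_abs (K := M + 5) (D := D) (a := a) (b := b) (p := p)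
    (g := fun i j => 4 + V i j - Eb) (u := U) (by linarith) hgEb (by linarith) (by omega)
    (fun i _ j hj => tiltSol_bottom _ hW2 i hj) hUr
    ⟨(j₁ + p) % 2, by omega, j₁, hj₁, by omega, by
      rw [hU, tiltSol_left _ _ (by omega)]
      simp only [hW, hw, hj₁, dif_pos, not_lt.mpr hj₁2, if_false]
      rw [abs_div, abs_of_pos hN0, le_div_iff₀ hN0, one_mul]
      rcases abs_choice (u ((j₁ + p) % 2) j₁) with h | h
      · rw [← h, ← hm, div_self hm0.ne', mul_one, round_natCast]
        simp
      · have h' : u ((j₁ + p) % 2) j₁ = -m := by rw [hm, h, neg_neg]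
        have h'' : (N : ℝ) * (-m / m) = ((-(N : ℤ) : ℤ) : ℝ) := by
          push_cast
          rw [neg_div, div_self hm0.ne']
          ring
        rw [h', h'', round_intCast]
        simp⟩
  rw [← hP] at hlow
  refine ⟨w, fun k => ?_, j, hj2, ?_, hlow, htopU⟩
  · simp only [hw]
    split_ifs
    · simp
    · have h1 := abs_sub_round (N * (u ((k + p) % 2) k / m))
      have h2 := hratio k k.2
      set x := u (((k : ℕ) + p) % 2) k / m
      have h3 : |(N : ℝ) * x| ≤ N := by
        rw [abs_mul, abs_of_pos hN0]
        exact mul_le_of_le_one_right hN0.le h2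
      have h4 : (|round ((N : ℝ) * x)| : ℝ) < N + 1 := by
        have := abs_sub (N * x) (N * x - round (N * x))
        rw [sub_sub_cancel] at this
        linarith
      have h5 : |round ((N : ℝ) * x)| < (N : ℤ) + 1 := by exact_mod_cast h4
      omega
  · by_contra hcon
    have hjb' : b ≤ j + 2 := by omega
    have h1 := htopU j hjb hjb'
    have h2 := le_two_mul_card_filter_mod_two a (j + p)
    have h3 : ((Finset.range a).filter fun i => (i + j + p) % 2 = 0 ∧ 2 / P ^ 2 < |U i j|)
        = (Finset.range a).filter fun i => (i + (j + p)) % 2 = 0 := by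
      apply Finset.filter_congr
      intro i hi
      rw [← add_assoc, and_iff_left_iff_imp]
      intro hv
      refine lt_of_lt_of_le ?_ (hlow i (Finset.mem_range.mp hi) hv)
      rw [div_lt_div_iff₀ (by positivity) hP0]
      nlinarith
    rw [h3] at h1
    have h4 : (a : ℝ) ≤ 2 * ((Finset.range a).filter fun i => (i + (j + p)) % 2 = 0).card + 1 := by
      exact_mod_cast h2
    nlinarith

lemma measure_pi_exists_notMem_eq_zero {ι : Type*} [Fintype ι] (μ : ι → Measure ℝ)
    [∀ i, IsProbabilityMeasure (μ i)] {s : Set ℝ} (hs : MeasurableSet s) (hμ : ∀ k, μ k s = 1) :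
    Measure.pi μ {ω | ∃ k, ω k ∉ s} = 0 := by
  have : {ω : ι → ℝ | ∃ k, ω k ∉ s} = ⋃ k, Function.eval k ⁻¹' sᶜ := by
    ext; simp
  rw [this, measure_iUnion_null_iff]
  intro k
  exact (measurePreserving_eval μ k).quasiMeasurePreserving.preimage_null
    ((prob_compl_eq_zero_iff hs).mpr (hμ k))

open scoped ENNReal in
/-- Strips with a random potential, frozen at a small proportion of every row, are good with
overwhelming probability. -/
lemma measure_not_stripGood_le {ι : Type*} [Fintype ι] (μ : ι → Measure ℝ)
    [∀ i, IsProbabilityMeasure (μ i)] {M γ₀ ρ D Eb P c : ℝ} (hγ : 0 < γ₀) (hρ : 0 < ρ) (hρ1 : ρ ≤ 1)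
    (hsupp : ∀ k, μ k (Set.Icc 0 M) = 1)
    (hac : ∀ k, ∀ t ∈ Set.Icc (0 : ℝ) M, ENNReal.ofReal ρ ≤ μ k {s | γ₀ / 2 < |s - t|})
    (hEb : Eb ∈ Set.Icc 0 (8 + M)) (hD : 4 * (M + 9) + 8 / γ₀ ≤ D) {a b p : ℕ} (ha : 16 ≤ a)
    (hb : 1 ≤ b) (hP : P = (D * a) ^ b) (hc : c = ρ / 64) (hlog : b ^ 2 * Real.log (D * a) ≤ c * a)
    {κ : ℕ → ℕ → Option ι} {q : ℕ → ℕ → ℝ}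
    (hκ : ∀ i j i' j' k, κ i j = some k → κ i' j' = some k → i = i' ∧ j = j')
    (hq : ∀ i j, q i j ∈ Set.Icc 0 M)
    (hfree : ∀ j < b,
      ((((Finset.range a).filter fun i => (i + j + p) % 2 = 0 ∧ κ i j = none).card : ℕ) : ℝ)
        ≤ c * a) :
    Measure.pi μ {ω | ¬ StripGood a b p P Eb c (chartPot κ q ω)}
      ≤ ENNReal.ofReal (Real.exp (-c * a)) := by
  have hM : 0 ≤ M := (hq 0 0).1.trans (hq 0 0).2
  have haR : (16 : ℝ) ≤ a := by exact_mod_cast ha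
  have hγ8 : 0 < 8 / γ₀ := by positivity
  have hDa : 576 ≤ D * a := by nlinarith
  have hDP : D * a ≤ P := by rw [hP]; exact le_self_pow₀ (by linarith) (by omega)
  have hP1 : 576 ≤ P := hDa.trans hDP
  have hP0 : 0 < P := by linarith
  have hPγ : 8 / γ₀ ≤ P := by nlinarith
  have hc0 : 0 < c := by rw [hc]; positivity
  have hc64 : c ≤ 1 / 64 := by rw [hc]; linarith
  set θ : ℝ≥0∞ := 1 - ENNReal.ofReal ρ with hθ
  have hac' : ∀ (k : ι) (t : ℝ), μ k {s | |s - t| ≤ γ₀ / 2} ≤ θ := fun k t =>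
    measure_abs_sub_le hM (hsupp k) (hac k) t
  set N := ⌈P ^ 3⌉₊ with hN
  set cc := ⌊c * a⌋₊ with hcc
  set S : ℕ → Finset ℕ := fun j => (Finset.range a).filter fun i =>
    i + 2 < a ∧ (i + 1 + (j + 1) + p) % 2 = 0 ∧ κ (i + 1) (j + 1) ≠ none with hS
  set T : ℕ → ℕ := fun j => j + 2 + 2 * ((b - 3 - j) / 2) with hT
  set U : (Fin b → ℤ) → (ι → ℝ) → ℕ → ℕ → ℝ := fun w ω =>
    tiltSol (fun i j => 4 + chartPot κ q ω i j - Eb)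
      (fun j => if h : j < b then (w ⟨j, h⟩ : ℝ) / N else 0) with hU
  set Bad : (Fin b → ℤ) × ℕ → Set (ι → ℝ) := fun x =>
    {ω | (∀ i ∈ S x.2, 1 / P ≤ |U x.1 ω (i + 1) (x.2 + 1)|) ∧
        ((Finset.range a).filter fun i => (i + T x.2 + p) % 2 = 0 ∧
          2 / P ^ 2 < |U x.1 ω i (T x.2)|).card ≤ cc} with hBad
  set G : Finset ((Fin b → ℤ) × ℕ) :=
    (Fintype.piFinset fun _ : Fin b => Finset.Icc (-(N : ℤ)) N) ×ˢ Finset.range (b - 2) with hG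
  have hnull := measure_pi_exists_notMem_eq_zero μ measurableSet_Icc hsupp
  have hcover : {ω | ¬ StripGood a b p P Eb c (chartPot κ q ω)}
      ⊆ {ω | ∃ k, ω k ∉ Set.Icc 0 M} ∪ ⋃ x ∈ G, Bad x := by
    intro ω hω
    rw [Set.mem_ofPred_eq] at hω
    by_cases hωM : ∃ k, ω k ∉ Set.Icc 0 M
    · left; exact hωM
    right
    push Not at hωM
    have hV : ∀ i j, chartPot κ q ω i j ∈ Set.Icc 0 M := by
      intro i j
      unfold chartPot
      cases κ i j with
      | none => exact hq i j
      | some k => exact hωM k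
    obtain ⟨w, hw, j, hj2, hjb, hlow, htop⟩ :=
      exists_grid_of_not_stripGood hV hEb (by linarith) ha hb hc64 hP hω
    obtain ⟨j, rfl⟩ : ∃ j', j = j' + 1 := ⟨j - 1, by omega⟩
    simp only [Set.mem_iUnion]
    refine ⟨(w, j), ?_, ?_, ?_⟩
    · simp only [hG, Finset.mem_product, Fintype.mem_piFinset, Finset.mem_Icc, Finset.mem_range]
      exact ⟨fun k => abs_le.mp (hw k), by omega⟩
    · intro i hi
      simp only [hS, Finset.mem_filter] at hi
      exact hlow (i + 1) (by omega) hi.2.2.1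
    · exact Nat.le_floor (htop (T j) (by simp only [hT]; omega) (by simp only [hT]; omega))
  have hScard : ∀ j, j + 2 < b → (a : ℝ) / 4 ≤ (S j).card := by
    intro j hj
    have h1 := le_two_mul_card_filter_mod_two (a - 2) (j + 2 + p)
    have h2 : ((Finset.range (a - 2)).filter fun i => (i + (j + 2 + p)) % 2 = 0) ⊆ S j ∪
        (Finset.range a).filter fun i => i + 1 ∈
          (Finset.range a).filter fun i => (i + (j + 1) + p) % 2 = 0 ∧ κ i (j + 1) = none := by
      intro i hi
      simp only [hS, Finset.mem_filter, Finset.mem_range, Finset.mem_union] at hi ⊢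
      by_cases h : κ (i + 1) (j + 1) = none
      · right; exact ⟨by omega, by omega, by omega, h⟩
      · left; exact ⟨by omega, by omega, by omega, h⟩
    have h3 : ((Finset.range a).filter fun i => i + 1 ∈
          (Finset.range a).filter fun i => (i + (j + 1) + p) % 2 = 0 ∧ κ i (j + 1) = none).card ≤
        ((Finset.range a).filter fun i => (i + (j + 1) + p) % 2 = 0 ∧ κ i (j + 1) = none).card :=
      Finset.card_le_card_of_injOn (fun i => i + 1) (fun i hi => (Finset.mem_filter.mp hi).2)
        (fun x _ y _ h => by simpa using h)
    have h4 := hfree (j + 1) (by omega)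
    have h5 := (Finset.card_le_card h2).trans (Finset.card_union_le _ _)
    have h6 : a ≤ 2 * ((S j).card + ((Finset.range a).filter fun i =>
        (i + (j + 1) + p) % 2 = 0 ∧ κ i (j + 1) = none).card) + 3 := by omega
    have h7 : (a : ℝ) ≤ 2 * ((S j).card + (((Finset.range a).filter fun i =>
        (i + (j + 1) + p) % 2 = 0 ∧ κ i (j + 1) = none).card : ℕ)) + 3 := by exact_mod_cast h6
    nlinarith
  have hθ' : (2⁻¹ + 2⁻¹ * θ : ℝ≥0∞) ≤ ENNReal.ofReal (Real.exp (-ρ / 2)) := by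
    have e2 : (2⁻¹ : ℝ≥0∞) = ENNReal.ofReal 2⁻¹ := by
      rw [ENNReal.ofReal_inv_of_pos (by norm_num)]; simp
    rw [hθ, ← ENNReal.ofReal_one, ← ENNReal.ofReal_sub _ hρ.le, e2,
      ← ENNReal.ofReal_mul (by norm_num), ← ENNReal.ofReal_add (by norm_num) (by linarith)]
    apply ENNReal.ofReal_le_ofReal
    have := Real.add_one_le_exp (-ρ / 2)
    linarith
  have hBadm : ∀ x ∈ G, Measure.pi μ (Bad x) ≤ ENNReal.ofReal (Real.exp (-(6 * (c * a)))) := by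
    rintro ⟨w, j⟩ hx
    simp only [hG, Finset.mem_product, Finset.mem_range] at hx
    refine (measure_few_large_le μ hac' q hκ Eb
      (fun j => if h : j < b then (w ⟨j, h⟩ : ℝ) / N else 0) j ((b - 3 - j) / 2) a p cc
      (δ := 1 / P) (δ' := 2 / P ^ 2) (by positivity) ?_ (S j) ?_).trans ?_
    · have : 2 * (2 / P ^ 2) / (1 / P) = 4 / P := by field_simp; norm_num
      rw [this, div_le_div_iff₀ hP0 (by norm_num)]
      rw [div_le_iff₀ hγ] at hPγ
      linarith
    · intro i hi
      simp only [hS, Finset.mem_filter] at hi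
      exact hi.2
    · have h2 : (2 : ℝ≥0∞) ^ (2 * cc) ≤ ENNReal.ofReal (Real.exp (2 * (c * a))) := by
        have : (2 : ℝ≥0∞) = ENNReal.ofReal 2 := by simp
        rw [this, ← ENNReal.ofReal_pow (by norm_num)]
        apply ENNReal.ofReal_le_ofReal
        have h2e : (2 : ℝ) ≤ Real.exp 1 := by
          have := Real.add_one_le_exp (1 : ℝ); linarith
        calc (2 : ℝ) ^ (2 * cc) ≤ Real.exp 1 ^ (2 * cc) := pow_le_pow_left₀ (by norm_num) h2e _
          _ = Real.exp ((2 * cc : ℕ) * 1) := (Real.exp_nat_mul _ _).symm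
          _ ≤ _ := by
            apply Real.exp_le_exp.mpr
            push_cast
            have := Nat.floor_le (by positivity : 0 ≤ c * a)
            linarith
      have h3 : (2⁻¹ + 2⁻¹ * θ : ℝ≥0∞) ^ (S j).card ≤ ENNReal.ofReal (Real.exp (-(8 * (c * a)))) := by
        refine (pow_le_pow_left' hθ' _).trans ?_
        rw [← ENNReal.ofReal_pow (Real.exp_nonneg _), ← Real.exp_nat_mul]
        apply ENNReal.ofReal_le_ofReal
        apply Real.exp_le_exp.mpr
        have := hScard j (by omega)
        rw [hc]
        nlinarith
      calc _ ≤ ENNReal.ofReal (Real.exp (2 * (c * a))) * ENNReal.ofReal (Real.exp (-(8 * (c * a)))) :=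
            mul_le_mul' h2 h3
        _ = _ := by
          rw [← ENNReal.ofReal_mul (Real.exp_nonneg _), ← Real.exp_add]
          ring_nf
  have hGcard : ((G.card : ℕ) : ℝ) ≤ Real.exp (5 * (c * a)) := by
    have hb1 : (1 : ℝ) ≤ b := by exact_mod_cast hb
    set X := Real.log (D * a) with hX
    have hX0 : 0 ≤ X := Real.log_nonneg (by linarith)
    have hPX : P = Real.exp (b * X) := by
      rw [hP, Real.exp_nat_mul, hX, Real.exp_log (by linarith)]
    have h1 : G.card = (2 * N + 1) ^ b * (b - 2) := by
      rw [hG, Finset.card_product, Finset.card_range, Fintype.card_piFinset_const, Int.card_Icc]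
      congr 2
      omega
    have h2 : ((2 * N + 1 : ℕ) : ℝ) ≤ P ^ 4 := by
      have : (N : ℝ) < P ^ 3 + 1 := Nat.ceil_lt_add_one (by positivity)
      push_cast
      have h3 : 1 ≤ P ^ 3 := one_le_pow₀ (by linarith)
      nlinarith
    have h3 : ((b - 2 : ℕ) : ℝ) ≤ P := by
      have : b - 2 ≤ 2 ^ b := (Nat.sub_le _ _).trans b.lt_two_pow_self.le
      calc ((b - 2 : ℕ) : ℝ) ≤ 2 ^ b := by exact_mod_cast this
        _ ≤ P := by rw [hP]; exact pow_le_pow_left₀ (by norm_num) (by linarith) _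
    calc ((G.card : ℕ) : ℝ) = ((2 * N + 1 : ℕ) : ℝ) ^ b * ((b - 2 : ℕ) : ℝ) := by rw [h1]; push_cast; rfl
      _ ≤ (P ^ 4) ^ b * P := by gcongr
      _ = Real.exp (4 * (b ^ 2 * X) + b * X) := by
        rw [Real.exp_add, ← hPX]
        congr 1
        rw [← pow_mul, hPX, ← Real.exp_nat_mul]
        push_cast
        ring_nf
      _ ≤ _ := by
        apply Real.exp_le_exp.mpr
        nlinarith [mul_le_mul_of_nonneg_right hb1 (by positivity : 0 ≤ b * X)]
  calc Measure.pi μ {ω | ¬ StripGood a b p P Eb c (chartPot κ q ω)}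
      ≤ Measure.pi μ {ω | ∃ k, ω k ∉ Set.Icc 0 M} + Measure.pi μ (⋃ x ∈ G, Bad x) :=
        (measure_mono hcover).trans (measure_union_le _ _)
    _ ≤ ∑ x ∈ G, Measure.pi μ (Bad x) := by
        rw [hnull, zero_add]; exact measure_biUnion_finset_le _ _
    _ ≤ G.card * ENNReal.ofReal (Real.exp (-(6 * (c * a)))) := by
        rw [← nsmul_eq_mul]; exact Finset.sum_le_card_nsmul _ _ _ hBadm
    _ ≤ ENNReal.ofReal (Real.exp (5 * (c * a))) * ENNReal.ofReal (Real.exp (-(6 * (c * a)))) := by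
        gcongr
        rw [← ENNReal.ofReal_natCast]
        exact ENNReal.ofReal_le_ofReal hGcard
    _ = _ := by
        rw [← ENNReal.ofReal_mul (Real.exp_nonneg _), ← Real.exp_add]
        ring_nf

/-- The tilted square with centre `c` and radius `R`. -/
def tSquare (c : ℤ × ℤ) (R : ℤ) : Set (ℤ × ℤ) :=
  tRect (c.1 + c.2 - R) (c.1 + c.2 + R) (c.1 - c.2 - R) (c.1 - c.2 + R)

/-- Four isometries of `ℤ²`, which turn the upper side of a centred tilted square into each of its
sides. -/
def frame : Bool × Bool → ℤ × ℤ → ℤ × ℤ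
  | (false, false), n => n
  | (true, false), n => (n.2, n.1)
  | (false, true), n => (n.1, -n.2)
  | (true, true), n => (n.2, -n.1)

/-- Tilted coordinate along the side `k` of tilted squares centred at `c`. -/
def alongCoord (c : ℤ × ℤ) : Bool × Bool → ℤ × ℤ → ℤ
  | (_, false), n => n.1 + n.2 - (c.1 + c.2)
  | (_, true), n => n.1 - n.2 - (c.1 - c.2)

/-- Tilted coordinate pointing outward across the side `k` of tilted squares centred at `c`. -/
def outCoord (c : ℤ × ℤ) : Bool × Bool → ℤ × ℤ → ℤ
  | (false, false), n => n.1 - n.2 - (c.1 - c.2)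
  | (true, false), n => -(n.1 - n.2 - (c.1 - c.2))
  | (false, true), n => n.1 + n.2 - (c.1 + c.2)
  | (true, true), n => -(n.1 + n.2 - (c.1 + c.2))

/-- The chart of the strip of width `2 * w + 1` over the side `k` of the tilted square of centre `c`
and radius `r`. It is meaningful at indices with `(i + j + (w + r + 1)) % 2 = 0`. -/
def stripSite (c : ℤ × ℤ) (k : Bool × Bool) (w r i j : ℕ) : ℤ × ℤ :=
  c + frame k (((i - w : ℤ) + (j + r - 1)) / 2, ((i - w : ℤ) - (j + r - 1)) / 2)

lemma mem_tSquare_iff {c : ℤ × ℤ} (k : Bool × Bool) {R : ℤ} {n : ℤ × ℤ} :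
    n ∈ tSquare c R ↔ |alongCoord c k n| ≤ R ∧ |outCoord c k n| ≤ R := by
  simp only [tSquare, tRect, Set.mem_ofPred_eq, abs_le]
  obtain ⟨_ | _, _ | _⟩ := k <;> simp only [alongCoord, outCoord] <;> constructor <;> intro h <;>
    refine ⟨?_, ?_⟩ <;> omega

lemma stripSite_coords {c : ℤ × ℤ} {k : Bool × Bool} {w r i j : ℕ}
    (h : (i + j + (w + r + 1)) % 2 = 0) :
    alongCoord c k (stripSite c k w r i j) = i - w ∧
      outCoord c k (stripSite c k w r i j) = j + r - 1 := by
  obtain ⟨_ | _, _ | _⟩ := k <;>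
    simp only [alongCoord, outCoord, stripSite, frame, Prod.fst_add, Prod.snd_add] <;> omega

lemma exists_stripSite {c : ℤ × ℤ} (k : Bool × Bool) (w r : ℕ) {n : ℤ × ℤ}
    (h1 : |alongCoord c k n| ≤ w) (h2 : (r : ℤ) - 1 ≤ outCoord c k n) :
    ∃ i j : ℕ, i < 2 * w + 1 ∧ (j : ℤ) = outCoord c k n - r + 1 ∧
      (i + j + (w + r + 1)) % 2 = 0 ∧ stripSite c k w r i j = n := by
  refine ⟨(alongCoord c k n + w).toNat, (outCoord c k n - r + 1).toNat, ?_, ?_, ?_, ?_⟩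
  · rw [abs_le] at h1; omega
  · omega
  · rw [abs_le] at h1
    obtain ⟨_ | _, _ | _⟩ := k <;> simp only [alongCoord, outCoord] at h1 h2 ⊢ <;> omega
  · rw [abs_le] at h1
    obtain ⟨_ | _, _ | _⟩ := k <;> simp only [alongCoord, outCoord] at h1 h2 ⊢ <;>
      ext <;> simp only [stripSite, frame, Prod.fst_add, Prod.snd_add] <;> omega

lemma stripSite_injective {c : ℤ × ℤ} {k : Bool × Bool} {w r i j i' j' : ℕ}
    (h : (i + j + (w + r + 1)) % 2 = 0) (h' : (i' + j' + (w + r + 1)) % 2 = 0)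
    (e : stripSite c k w r i j = stripSite c k w r i' j') : i = i' ∧ j = j' := by
  have h1 := stripSite_coords (c := c) (k := k) h
  have h2 := stripSite_coords (c := c) (k := k) h'
  rw [e] at h1
  omega

lemma tiltDefect_stripSite {V ψ : ℤ × ℤ → ℝ} {E : ℝ} {S : Set (ℤ × ℤ)} (hψ : EigOn V E ψ S)
    {c : ℤ × ℤ} {k : Bool × Bool} {w r i j : ℕ} (h : (i + j + (w + r + 1)) % 2 = 0)
    (hS : stripSite c k w r (i + 1) (j + 1) ∈ S) :
    tiltDefect (fun i j => 4 + V (stripSite c k w r i j) - E)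
      (fun i j => ψ (stripSite c k w r i j)) i j = 0 := by
  obtain ⟨x, hx⟩ : ∃ x : ℤ, 2 * x = ((i + 1 : ℕ) - w : ℤ) + ((j + 1 : ℕ) + r - 1) :=
    ⟨(((i + 1 : ℕ) - w : ℤ) + ((j + 1 : ℕ) + r - 1)) / 2, by push_cast; omega⟩
  obtain ⟨y, hy⟩ : ∃ y : ℤ, 2 * y = ((i + 1 : ℕ) - w : ℤ) - ((j + 1 : ℕ) + r - 1) :=
    ⟨(((i + 1 : ℕ) - w : ℤ) - ((j + 1 : ℕ) + r - 1)) / 2, by push_cast; omega⟩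
  have e0 : stripSite c k w r (i + 1) (j + 1) = c + frame k (x, y) := by
    unfold stripSite; congr 3 <;> omega
  have e1 : stripSite c k w r (i + 2) (j + 2) = c + frame k (x + 1, y) := by
    unfold stripSite; congr 3 <;> push_cast at * <;> omega
  have e2 : stripSite c k w r i j = c + frame k (x - 1, y) := by
    unfold stripSite; congr 3 <;> push_cast at * <;> omega
  have e3 : stripSite c k w r (i + 2) j = c + frame k (x, y + 1) := by
    unfold stripSite; congr 3 <;> push_cast at * <;> omega
  have e4 : stripSite c k w r i (j + 2) = c + frame k (x, y - 1) := by
    unfold stripSite; congr 3 <;> push_cast at * <;> omega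
  have hE := hψ _ hS
  simp only [tiltDefect]
  rw [e1, e2, e3, e4]
  rw [e0] at hE ⊢
  obtain ⟨c1, c2⟩ := c
  obtain ⟨_ | _, _ | _⟩ := k <;> simp only [frame, Prod.mk_add_mk] at hE ⊢
  · have a1 : c1 + (x + 1) = c1 + x + 1 := by ring
    have a2 : c1 + (x - 1) = c1 + x - 1 := by ring
    have a3 : c2 + (y + 1) = c2 + y + 1 := by ring
    have a4 : c2 + (y - 1) = c2 + y - 1 := by ring
    rw [a1, a2, a3, a4]; linarith
  · have a1 : c1 + (x + 1) = c1 + x + 1 := by ring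
    have a2 : c1 + (x - 1) = c1 + x - 1 := by ring
    have a3 : c2 + -(y + 1) = c2 + -y - 1 := by ring
    have a4 : c2 + -(y - 1) = c2 + -y + 1 := by ring
    rw [a1, a2, a3, a4]; linarith
  · have a1 : c2 + (x + 1) = c2 + x + 1 := by ring
    have a2 : c2 + (x - 1) = c2 + x - 1 := by ring
    have a3 : c1 + (y + 1) = c1 + y + 1 := by ring
    have a4 : c1 + (y - 1) = c1 + y - 1 := by ring
    rw [a1, a2, a3, a4]; linarith
  · have a1 : c2 + -(x + 1) = c2 + -x - 1 := by ring
    have a2 : c2 + -(x - 1) = c2 + -x + 1 := by ring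
    have a3 : c1 + (y + 1) = c1 + y + 1 := by ring
    have a4 : c1 + (y - 1) = c1 + y - 1 := by ring
    rw [a1, a2, a3, a4]; linarith

/-- A bound on a tilted square propagates to a larger one once it propagates through the strips over
its four sides. -/
lemma abs_le_tSquare_add {ψ : ℤ × ℤ → ℝ} {c : ℤ × ℤ} {r d : ℕ} {B G : ℝ} (hB : 1 ≤ B) (hG : 1 ≤ G)
    (hr : 1 ≤ r)
    (hstrip : ∀ k : Bool × Bool, ∀ w, r ≤ w → w ≤ r + d → ∀ B' : ℝ, 1 ≤ B' →
      (∀ i < 2 * w + 1, ∀ j < 2, (i + j + (w + r + 1)) % 2 = 0 → |ψ (stripSite c k w r i j)| ≤ B') →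
      ∀ i < 2 * w + 1, ∀ j < d + 2, (i + j + (w + r + 1)) % 2 = 0 →
        |ψ (stripSite c k w r i j)| ≤ B' * G)
    (hψ : ∀ n ∈ tSquare c r, |ψ n| ≤ B) : ∀ n ∈ tSquare c (r + d : ℕ), |ψ n| ≤ B * G ^ 2 := by
  have hBG : B ≤ B * G := le_mul_of_one_le_right (by linarith) hG
  have key : ∀ k : Bool × Bool, ∀ w, r ≤ w → w ≤ r + d → ∀ B' : ℝ, 1 ≤ B' →
      (∀ n, |alongCoord c k n| ≤ w → |outCoord c k n| ≤ r → |ψ n| ≤ B') →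
      ∀ n, |alongCoord c k n| ≤ w → outCoord c k n ≤ (r + d : ℕ) → (r : ℤ) ≤ outCoord c k n →
        |ψ n| ≤ B' * G := by
    intro k w hw1 hw2 B' hB' hin n hn1 hn2 hn3
    obtain ⟨i, j, hi, hj, hv, rfl⟩ := exists_stripSite k w r hn1 (by omega)
    refine hstrip k w hw1 hw2 B' hB' ?_ i hi j (by omega) hv
    intro i hi j hj hv
    obtain ⟨h1, h2⟩ := stripSite_coords (c := c) (k := k) hv
    apply hin
    · rw [h1, abs_le]; omega
    · rw [h2, abs_le]; omega
  have h1 : ∀ n, |alongCoord c (false, false) n| ≤ r → |outCoord c (false, false) n| ≤ (r + d : ℕ) →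
      |ψ n| ≤ B * G := by
    intro n hn1 hn2
    rw [abs_le] at hn2
    rcases lt_or_ge (|outCoord c (false, false) n|) r with h | h
    · exact (hψ n ((mem_tSquare_iff (false, false)).mpr ⟨hn1, h.le⟩)).trans hBG
    rcases le_abs.mp h with h | h
    · exact key (false, false) r le_rfl (by omega) B hB
        (fun n h1 h2 => hψ n ((mem_tSquare_iff _).mpr ⟨h1, h2⟩)) n hn1 hn2.2 h
    · refine key (true, false) r le_rfl (by omega) B hB
        (fun n h1 h2 => hψ n ((mem_tSquare_iff _).mpr ⟨h1, h2⟩)) n hn1 ?_ ?_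
      · simp only [outCoord] at hn2 ⊢; omega
      · simp only [outCoord] at h ⊢; omega
  intro n hn
  obtain ⟨hn1, hn2⟩ := (mem_tSquare_iff (false, true)).mp hn
  rw [pow_two, ← mul_assoc]
  have hside : ∀ b' : Bool, ∀ n, |alongCoord c (b', true) n| ≤ (r + d : ℕ) →
      |outCoord c (b', true) n| ≤ r → |ψ n| ≤ B * G := by
    intro b' n h2 h3
    apply h1 n
    · cases b'
      · exact h3
      · simp only [outCoord, abs_neg] at h3; exact h3
    · cases b' <;> exact h2
  rw [abs_le] at hn2
  rcases lt_or_ge (|outCoord c (false, true) n|) r with h | h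
  · exact (hside false n hn1 h.le).trans (le_mul_of_one_le_right (by nlinarith) hG)
  rcases le_abs.mp h with h | h
  · exact key (false, true) (r + d) (by omega) le_rfl (B * G) (by nlinarith) (hside false) n hn1
      hn2.2 h
  · refine key (true, true) (r + d) (by omega) le_rfl (B * G) (by nlinarith) (hside true) n hn1 ?_ ?_
    · simp only [outCoord] at hn2 ⊢; omega
    · simp only [outCoord] at h ⊢; omega

/-- The index in `Λ` of a site of a strip, if there is one. -/
def freeSite (Λ : Finset (ℤ × ℤ)) (c : ℤ × ℤ) (k : Bool × Bool) (w r i j : ℕ) : Option Λ :=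
  if h : (i + j + (w + r + 1)) % 2 = 0 ∧ stripSite c k w r i j ∈ Λ then
    some ⟨stripSite c k w r i j, h.2⟩ else none

/-- The frozen part of the potential on a strip. -/
def frozenPot (F : Set (ℤ × ℤ)) (v : ℤ × ℤ → ℝ) (c : ℤ × ℤ) (k : Bool × Bool) (w r i j : ℕ) : ℝ :=
  if stripSite c k w r i j ∈ F then v (stripSite c k w r i j) else 0

/-- The set of sites at which an outward coordinate takes a given value. -/
def outDiag (c : ℤ × ℤ) (k : Bool × Bool) (t : ℤ) : Set (ℤ × ℤ) := {n | outCoord c k n = t}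

lemma freeSite_injective {Λ : Finset (ℤ × ℤ)} {c : ℤ × ℤ} {k : Bool × Bool} {w r : ℕ}
    (i j i' j' : ℕ) (x : Λ) (h : freeSite Λ c k w r i j = some x)
    (h' : freeSite Λ c k w r i' j' = some x) : i = i' ∧ j = j' := by
  unfold freeSite at h h'
  split_ifs at h with h1
  split_ifs at h' with h2
  apply stripSite_injective h1.1 h2.1
  rw [← h', Option.some.injEq, Subtype.mk.injEq] at h
  exact h

lemma frozenPot_mem {M : ℝ} (hM : 0 ≤ M) {F : Set (ℤ × ℤ)} {v : ℤ × ℤ → ℝ}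
    (hv : ∀ n ∈ F, v n ∈ Set.Icc (0 : ℝ) M) (c : ℤ × ℤ) (k : Bool × Bool) (w r i j : ℕ) :
    frozenPot F v c k w r i j ∈ Set.Icc 0 M := by
  unfold frozenPot
  split_ifs with h
  · exact hv _ h
  · exact ⟨le_rfl, hM⟩

lemma chartPot_freeSite {Λ : Finset (ℤ × ℤ)} {F : Set (ℤ × ℤ)} (v : ℤ × ℤ → ℝ)
    (W : (Λ.filter (· ∉ F) : Finset (ℤ × ℤ)) → ℝ) {c : ℤ × ℤ} {k : Bool × Bool} {w r i j : ℕ}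
    (h : (i + j + (w + r + 1)) % 2 = 0) (hΛ : stripSite c k w r i j ∈ Λ) :
    chartPot (freeSite (Λ.filter (· ∉ F)) c k w r) (frozenPot F v c k w r) W i j
      = if stripSite c k w r i j ∈ F then v (stripSite c k w r i j)
        else extV (Λ.filter (· ∉ F)) W (stripSite c k w r i j) := by
  by_cases hF : stripSite c k w r i j ∈ F
  · have : ¬ ((i + j + (w + r + 1)) % 2 = 0 ∧ stripSite c k w r i j ∈ Λ.filter (· ∉ F)) := by
      simp [hF]
    simp [chartPot, freeSite, frozenPot, hF]
  · simp [chartPot, freeSite, extV, hF, h, hΛ]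

lemma SparseIn.ncard_outDiag_le {ε : ℝ} {F R : Set (ℤ × ℤ)} (h : SparseIn ε F R) (c : ℤ × ℤ)
    (k : Bool × Bool) (t : ℤ) :
    ((F ∩ R ∩ outDiag c k t).ncard : ℝ) ≤ ε * ((R ∩ outDiag c k t).ncard : ℝ) := by
  obtain ⟨_ | _, _ | _⟩ := k
  · have : outDiag c (false, false) t = {n | n.1 - n.2 = t + (c.1 - c.2)} := by
      ext n; simp only [outDiag, outCoord, Set.mem_ofPred_eq]; omega
    rw [this]; exact (h _).2
  · have : outDiag c (false, true) t = {n | n.1 + n.2 = t + (c.1 + c.2)} := by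
      ext n; simp only [outDiag, outCoord, Set.mem_ofPred_eq]; omega
    rw [this]; exact (h _).1
  · have : outDiag c (true, false) t = {n | n.1 - n.2 = -t + (c.1 - c.2)} := by
      ext n; simp only [outDiag, outCoord, Set.mem_ofPred_eq]; omega
    rw [this]; exact (h _).2
  · have : outDiag c (true, true) t = {n | n.1 + n.2 = -t + (c.1 + c.2)} := by
      ext n; simp only [outDiag, outCoord, Set.mem_ofPred_eq]; omega
    rw [this]; exact (h _).1

lemma eq_of_coords_eq {c : ℤ × ℤ} (k : Bool × Bool) {n n' : ℤ × ℤ}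
    (h1 : alongCoord c k n = alongCoord c k n') (h2 : outCoord c k n = outCoord c k n') : n = n' := by
  obtain ⟨_ | _, _ | _⟩ := k <;> simp only [alongCoord, outCoord] at h1 h2 <;> ext <;> omega

lemma finite_tSquare (c : ℤ × ℤ) (R : ℤ) : (tSquare c R).Finite := by
  refine ((Set.finite_Icc (c.1 - R) (c.1 + R)).prod (Set.finite_Icc (c.2 - R) (c.2 + R))).subset ?_
  intro n hn
  simp only [tSquare, tRect, Set.mem_ofPred_eq] at hn
  simp only [Set.mem_prod, Set.mem_Icc]
  omega

lemma ncard_tSquare_inter_outDiag_le (c : ℤ × ℤ) (R : ℕ) (k : Bool × Bool) (t : ℤ) :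
    (tSquare c R ∩ outDiag c k t).ncard ≤ 2 * R + 1 := by
  have : (tSquare c R ∩ outDiag c k t).ncard ≤ (Set.Icc (-(R : ℤ)) R).ncard := by
    apply Set.ncard_le_ncard_of_injOn (alongCoord c k)
    · intro n hn
      exact abs_le.mp ((mem_tSquare_iff k).mp hn.1).1
    · intro n hn n' hn' h
      have e : outCoord c k n = t := hn.2
      have e' : outCoord c k n' = t := hn'.2
      exact eq_of_coords_eq k h (e.trans e'.symm)
  refine this.trans (le_of_eq ?_)
  rw [Set.ncard_eq_toFinset_card', Set.toFinset_Icc, Int.card_Icc]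
  omega

lemma stripSite_mem_tSquare {c : ℤ × ℤ} (k : Bool × Bool) {w r i j R : ℕ} (hr : 1 ≤ r)
    (h : (i + j + (w + r + 1)) % 2 = 0) (hi : i < 2 * w + 1) (hw : w ≤ R) (hj : j + r ≤ R + 1) :
    stripSite c k w r i j ∈ tSquare c R := by
  obtain ⟨h1, h2⟩ := stripSite_coords (c := c) (k := k) h
  rw [mem_tSquare_iff k, h1, h2, abs_le, abs_le]
  omega

lemma card_filter_stripSite_le {c : ℤ × ℤ} (k : Bool × Bool) {w r j R : ℕ} (hr : 1 ≤ r)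
    (hw : w ≤ R) (hj : j + r ≤ R + 1) (A : Set (ℤ × ℤ)) :
    ((Finset.range (2 * w + 1)).filter fun i =>
        (i + j + (w + r + 1)) % 2 = 0 ∧ stripSite c k w r i j ∈ A).card
      ≤ (A ∩ tSquare c R ∩ outDiag c k (j + r - 1)).ncard := by
  rw [← Set.ncard_coe_finset]
  refine Set.ncard_le_ncard_of_injOn (fun i => stripSite c k w r i j) ?_ ?_
    (((finite_tSquare c R).subset Set.inter_subset_right).subset Set.inter_subset_left)
  · intro i hi
    simp only [Finset.coe_filter, Finset.mem_range, Set.mem_ofPred_eq] at hi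
    exact ⟨⟨hi.2.2, stripSite_mem_tSquare k hr hi.2.1 hi.1 hw hj⟩, (stripSite_coords hi.2.1).2⟩
  · intro i hi i' hi' h
    simp only [Finset.coe_filter, Finset.mem_range, Set.mem_ofPred_eq] at hi hi'
    exact (stripSite_injective hi.2.1 hi'.2.1 h).1

lemma card_filter_frozen_le {c : ℤ × ℤ} (k : Bool × Bool) {w r j R : ℕ} (hr : 1 ≤ r)
    (hw : w ≤ R) (hj : j + r ≤ R + 1) {ε : ℝ} (hε : 0 ≤ ε) {F : Set (ℤ × ℤ)}
    (hF : SparseIn ε F (tSquare c R)) :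
    ((((Finset.range (2 * w + 1)).filter fun i =>
        (i + j + (w + r + 1)) % 2 = 0 ∧ stripSite c k w r i j ∈ F).card : ℕ) : ℝ)
      ≤ ε * (2 * R + 1) := by
  refine le_trans (Nat.cast_le.mpr (card_filter_stripSite_le k hr hw hj F)) ?_
  refine (hF.ncard_outDiag_le c k _).trans (mul_le_mul_of_nonneg_left ?_ hε)
  exact_mod_cast ncard_tSquare_inter_outDiag_le c R k _

/-- Among consecutive radii there is one for which a set has few points on the outer two layers of
the tilted square of that radius. -/
lemma exists_radius_ncard_outDiag_le {A : Set (ℤ × ℤ)} (hA : A.Finite) (c : ℤ × ℤ) {r d : ℕ}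
    (hd : 1 ≤ d) :
    ∃ T, r + d ≤ T ∧ T < r + 2 * d ∧ ∀ k : Bool × Bool, ∀ t : ℤ, t ≤ T → (T : ℤ) ≤ t + 1 →
      (d : ℝ) * ((A ∩ outDiag c k t).ncard : ℝ) ≤ 8 * (A.ncard : ℝ) := by
  set N : ℤ → ℕ := fun t => ∑ k : Bool × Bool, (A ∩ outDiag c k t).ncard with hN
  have hsum : ∀ s : ℤ, ∑ T ∈ Finset.Ico (r + d) (r + 2 * d), N (T - s) ≤ 4 * A.ncard := by
    intro s
    simp only [hN]
    rw [Finset.sum_comm]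
    calc _ ≤ ∑ _k : Bool × Bool, A.ncard := ?_
      _ = 4 * A.ncard := by simp
    refine Finset.sum_le_sum fun k _ => ?_
    rw [Set.ncard_eq_toFinset_card A hA]
    have e : ∀ T : ℕ, (A ∩ outDiag c k (T - s)).ncard
        = (hA.toFinset.filter fun n => outCoord c k n = T - s).card := by
      intro T
      rw [← Set.ncard_coe_finset]
      congr 1
      ext n
      simp [outDiag]
    simp only [e]
    rw [← Finset.card_biUnion]
    · apply Finset.card_le_card
      intro n hn
      simp only [Finset.mem_biUnion, Finset.mem_filter] at hn
      obtain ⟨_, _, h, _⟩ := hn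
      exact h
    · intro T _ T' _ hne
      rw [Function.onFun, Finset.disjoint_left]
      intro n hn hn'
      simp only [Finset.mem_filter] at hn hn'
      omega
  have htot : ∑ T ∈ Finset.Ico (r + d) (r + 2 * d), d * (N T + N (T - 1))
      ≤ ∑ _T ∈ Finset.Ico (r + d) (r + 2 * d), 8 * A.ncard := by
    rw [← Finset.mul_sum, Finset.sum_add_distrib, Finset.sum_const, Nat.card_Ico, smul_eq_mul]
    have h0 := hsum 0
    simp only [sub_zero] at h0
    have e : r + 2 * d - (r + d) = d := by omega
    rw [e]
    exact Nat.mul_le_mul_left _ (by have := hsum 1; omega)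
  obtain ⟨T, hT, hle⟩ := Finset.exists_le_of_sum_le ⟨r + d, by simp; omega⟩ htot
  rw [Finset.mem_Ico] at hT
  refine ⟨T, hT.1, hT.2, fun k t ht1 ht2 => ?_⟩
  have h1 : ∀ t', (A ∩ outDiag c k t').ncard ≤ N t' := fun t' =>
    Finset.single_le_sum (f := fun k => (A ∩ outDiag c k t').ncard) (fun _ _ => Nat.zero_le _)
      (Finset.mem_univ k)
  have h2 : (A ∩ outDiag c k t).ncard ≤ N T + N (T - 1) := by
    have : t = T ∨ t = T - 1 := by omega
    rcases this with rfl | rfl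
    · exact (h1 _).trans (Nat.le_add_right _ _)
    · exact (h1 _).trans (Nat.le_add_left _ _)
  exact_mod_cast (Nat.mul_le_mul_left d h2).trans hle

lemma abs_le_of_stripGood {Λ : Finset (ℤ × ℤ)} {F : Set (ℤ × ℤ)} {v : ℤ × ℤ → ℝ}
    {W : (Λ.filter (· ∉ F) : Finset (ℤ × ℤ)) → ℝ} {E Eb : ℝ} {ψ : ℤ × ℤ → ℝ}
    (hψ : EigOn (fun n => if n ∈ F then v n else extV (Λ.filter (· ∉ F)) W n) E ψ Λ)
    {c : ℤ × ℤ} {k : Bool × Bool} {w r b : ℕ} {P c₀ B : ℝ}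
    (hmem : ∀ i < 2 * w + 1, ∀ j < b, (i + j + (w + r + 1)) % 2 = 0 → stripSite c k w r i j ∈ Λ)
    (hgood : StripGood (2 * w + 1) b (w + r + 1) P Eb c₀
      (chartPot (freeSite (Λ.filter (· ∉ F)) c k w r) (frozenPot F v c k w r) W))
    (hE : |E - Eb| ≤ 1 / P ^ 4) (hB : 0 < B)
    (h0 : ∀ i < 2 * w + 1, ∀ j < 2, (i + j + (w + r + 1)) % 2 = 0 → |ψ (stripSite c k w r i j)| ≤ B)
    (htop : ∀ j < b, b ≤ j + 2 → ((((Finset.range (2 * w + 1)).filter fun i =>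
      (i + j + (w + r + 1)) % 2 = 0 ∧ B < |ψ (stripSite c k w r i j)|).card : ℕ) : ℝ)
        ≤ c₀ * (2 * w + 1 : ℕ)) :
    ∀ i < 2 * w + 1, ∀ j < b, (i + j + (w + r + 1)) % 2 = 0 →
      |ψ (stripSite c k w r i j)| ≤ B * P ^ 4 := by
  intro i hi j hj hv
  have h := hgood E (fun i j => ψ (stripSite c k w r i j) / B) hE ?_ ?_ ?_ i hi j hj hv
  · rwa [abs_div, abs_of_pos hB, div_le_iff₀ hB, mul_comm] at h
  · intro i j hi hj hv
    have hv' : (i + 1 + (j + 1) + (w + r + 1)) % 2 = 0 := by omega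
    have hm := hmem (i + 1) (by omega) (j + 1) (by omega) hv'
    have h1 := tiltDefect_stripSite hψ hv hm
    simp only [tiltDefect] at h1 ⊢
    rw [chartPot_freeSite v W hv' hm]
    linear_combination h1 / B
  · intro i hi j hj hv
    rw [abs_div, abs_of_pos hB, div_le_one hB]
    exact h0 i hi j hj hv
  · intro j hj hbj
    simp only [abs_div, abs_of_pos hB, one_lt_div hB]
    exact htop j hj hbj

/-- One value in a row, together with the two rows below it, controls the whole row. -/
lemma abs_row_le {K B : ℝ} {a p : ℕ} {g u : ℕ → ℕ → ℝ} (hK : 0 ≤ K) (hB : 0 ≤ B)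
    (hg : ∀ i, i + 2 < a → (i + p) % 2 = 0 → |g (i + 1) 1| ≤ K)
    (hr : ∀ i, i + 2 < a → (i + p) % 2 = 0 → tiltDefect g u i 0 = 0)
    (h0 : ∀ i < a, ∀ j < 2, (i + j + p) % 2 = 0 → |u i j| ≤ B) {i₀ : ℕ} (hi₀ : i₀ < a)
    (hv₀ : (i₀ + p) % 2 = 0) (hu₀ : |u i₀ 2| ≤ B) :
    ∀ i < a, (i + p) % 2 = 0 → |u i 2| ≤ B * (1 + a * (K + 2)) := by
  have hstep : ∀ i, i + 2 < a → (i + p) % 2 = 0 → |u (i + 2) 2 + u i 2| ≤ (K + 2) * B := by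
    intro i hi hv
    have h1 := hr i hi hv
    simp only [tiltDefect] at h1
    have h2 : u (i + 2) 2 + u i 2 = g (i + 1) 1 * u (i + 1) 1 - u (i + 2) 0 - u i 0 := by
      simp only [zero_add] at h1
      linarith
    have h3 := mul_le_mul (hg i hi hv) (h0 (i + 1) (by omega) 1 (by omega) (by omega))
      (abs_nonneg _) hK
    have h4 := h0 (i + 2) hi 0 (by omega) (by omega)
    have h5 := h0 i (by omega) 0 (by omega) (by omega)
    rw [h2]
    rw [← abs_mul, abs_le] at h3
    rw [abs_le] at h4 h5 ⊢
    constructor <;> linarith [h3.1, h3.2, h4.1, h4.2, h5.1, h5.2]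
  have hwalk : ∀ n i : ℕ, i < a → (i = i₀ + 2 * n ∨ i₀ = i + 2 * n) →
      |u i 2| ≤ B * (1 + n * (K + 2)) := by
    intro n
    induction n with
    | zero =>
      intro i _ h
      have : i = i₀ := by omega
      simpa [this] using hu₀
    | succ n ih =>
      intro i hi h
      push_cast
      rcases h with h | h
      · obtain ⟨i', rfl⟩ : ∃ i', i = i' + 2 := ⟨i - 2, by omega⟩
        have h1 := ih i' (by omega) (by omega)
        have h2 := hstep i' hi (by omega)
        rw [abs_le] at h1 h2 ⊢
        constructor <;> linarith [h1.1, h1.2, h2.1, h2.2]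
      · have h1 := ih (i + 2) (by omega) (by omega)
        have h2 := hstep i (by omega) (by omega)
        rw [abs_le] at h1 h2 ⊢
        constructor <;> linarith [h1.1, h1.2, h2.1, h2.2]
  intro i hi hv
  have hfin : ∀ n : ℕ, n ≤ a → B * (1 + n * (K + 2)) ≤ B * (1 + a * (K + 2)) := fun n hn => by
    have : (n : ℝ) ≤ a := by exact_mod_cast hn
    gcongr
  rcases le_total i i₀ with h | h
  · exact (hwalk ((i₀ - i) / 2) i hi (Or.inr (by omega))).trans (hfin _ (by omega))
  · exact (hwalk ((i - i₀) / 2) i hi (Or.inl (by omega))).trans (hfin _ (by omega))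

/-- Extension by one layer of a bound on a tilted square without exceptional sites nearby. -/
lemma abs_le_tSquare_succ {Λ : Finset (ℤ × ℤ)} {F : Set (ℤ × ℤ)} {V ψ : ℤ × ℤ → ℝ} {E : ℝ}
    (hψ : EigOn V E ψ Λ) {K ε B G : ℝ} (hK : 0 ≤ K) (hV : ∀ n ∈ Λ, |4 + V n - E| ≤ K) (hε : 0 ≤ ε)
    (hε' : 5 * ε < 1) (hB : 1 ≤ B) {c : ℤ × ℤ} {r : ℕ} (hr : 1 ≤ r)
    (hG : 1 + (2 * r + 3) * (K + 2) ≤ G) (hΛ : tSquare c (2 * r : ℕ) ⊆ Λ)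
    (hF : SparseIn ε F (tSquare c (2 * r : ℕ)))
    (hone : ∀ n ∈ tSquare c (2 * r : ℕ), n ∉ F → |ψ n| ≤ 1)
    (hin : ∀ n ∈ tSquare c r, |ψ n| ≤ B) : ∀ n ∈ tSquare c (r + 1 : ℕ), |ψ n| ≤ B * G ^ 2 := by
  have hr1 : (1 : ℝ) ≤ r := by exact_mod_cast hr
  have hG1 : 1 ≤ G := le_trans (by nlinarith) hG
  refine abs_le_tSquare_add hB hG1 hr ?_ hin
  intro k w hw1 hw2 B' hB' h0 i hi j hj hv
  have hB'G : B' ≤ B' * G := le_mul_of_one_le_right (by linarith) hG1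
  have hmem : ∀ i < 2 * w + 1, ∀ j < 3, (i + j + (w + r + 1)) % 2 = 0 →
      stripSite c k w r i j ∈ tSquare c (2 * r : ℕ) := fun i hi j hj hv =>
    stripSite_mem_tSquare k hr hv hi (by omega) (by omega)
  rcases lt_or_ge j 2 with hj2 | hj2
  · exact (h0 i hi j hj2 hv).trans hB'G
  obtain rfl : j = 2 := by omega
  obtain ⟨i₀, hi₀, hv₀, hu₀⟩ : ∃ i₀ < 2 * w + 1, (i₀ + 2 + (w + r + 1)) % 2 = 0 ∧
      |ψ (stripSite c k w r i₀ 2)| ≤ B' := by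
    by_contra! hcon
    have h1 := card_filter_frozen_le (c := c) k (w := w) (r := r) (j := 2) (R := 2 * r) hr (by omega)
      (by omega) hε hF
    have h2 := le_two_mul_card_filter_mod_two (2 * w + 1) (2 + (w + r + 1))
    have h3 : ((Finset.range (2 * w + 1)).filter fun i => (i + (2 + (w + r + 1))) % 2 = 0) ⊆
        (Finset.range (2 * w + 1)).filter fun i =>
          (i + 2 + (w + r + 1)) % 2 = 0 ∧ stripSite c k w r i 2 ∈ F := by
      intro i hi
      rw [Finset.mem_filter, Finset.mem_range] at hi ⊢
      have hv : (i + 2 + (w + r + 1)) % 2 = 0 := by omega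
      refine ⟨hi.1, hv, ?_⟩
      by_contra hiF
      have h4 := hcon i hi.1 hv
      have h5 := hone _ (hmem i hi.1 2 (by omega) hv) hiF
      linarith
    have h4 := Finset.card_le_card h3
    have h5 : r ≤ ((Finset.range (2 * w + 1)).filter fun i =>
          (i + 2 + (w + r + 1)) % 2 = 0 ∧ stripSite c k w r i 2 ∈ F).card := by omega
    have h6 : (r : ℝ) ≤ (((Finset.range (2 * w + 1)).filter fun i =>
          (i + 2 + (w + r + 1)) % 2 = 0 ∧ stripSite c k w r i 2 ∈ F).card : ℕ) := by exact_mod_cast h5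
    push_cast at h1
    nlinarith
  have hrow := abs_row_le (K := K) (B := B') (a := 2 * w + 1) (p := w + r + 1)
    (g := fun i j => 4 + V (stripSite c k w r i j) - E) (u := fun i j => ψ (stripSite c k w r i j))
    hK (by linarith) (fun i hi hv => hV _ (hΛ (hmem _ (by omega) 1 (by omega) (by omega))))
    (fun i hi hv => tiltDefect_stripSite hψ (by omega)
      (hΛ (hmem _ (by omega) 1 (by omega) (by omega)))) h0 hi₀ (by omega) hu₀ i hi (by omega)
  refine hrow.trans (mul_le_mul_of_nonneg_left (le_trans ?_ hG) (by linarith))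
  have : (w : ℝ) ≤ r + 1 := by exact_mod_cast hw2
  push_cast
  nlinarith

/-- Extension by a macroscopic layer of a bound on a tilted square with few exceptional sites
nearby. -/
lemma exists_abs_le_tSquare_add {Λ : Finset (ℤ × ℤ)} {F : Set (ℤ × ℤ)} {v : ℤ × ℤ → ℝ}
    {W : (Λ.filter (· ∉ F) : Finset (ℤ × ℤ)) → ℝ} {E Eb : ℝ} {ψ : ℤ × ℤ → ℝ}
    (hψ : EigOn (fun n => if n ∈ F then v n else extV (Λ.filter (· ∉ F)) W n) E ψ Λ)
    {c₀ ε τ B G D : ℝ} {c : ℤ × ℤ} {r d : ℕ} (hε : 0 ≤ ε) (hεc : 4 * ε ≤ c₀) (hB : 1 ≤ B)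
    (hD : 1 ≤ D) (hd : 1 ≤ d) (hdr : 2 * d ≤ r) (hτ0 : 0 ≤ τ) (hτ : 200 * τ * r ≤ c₀ * d)
    (hΛ : tSquare c (2 * r : ℕ) ⊆ Λ) (hF : SparseIn ε F (tSquare c (2 * r : ℕ)))
    (hbad : (({n | n ∈ Λ ∧ n ∉ F ∧ 1 < |ψ n|} ∩ tSquare c (2 * r : ℕ)).ncard : ℝ)
      ≤ τ * (2 * (2 * r : ℕ) + 1) ^ 2)
    (hgood : ∀ (k : Bool × Bool) (w b : ℕ), r ≤ w → w ≤ 2 * r → d + 2 ≤ b → b ≤ 2 * d + 1 →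
      StripGood (2 * w + 1) b (w + r + 1) ((D * (2 * w + 1 : ℕ)) ^ b) Eb c₀
        (chartPot (freeSite (Λ.filter (· ∉ F)) c k w r) (frozenPot F v c k w r) W))
    (hG : ((D * (4 * r + 1)) ^ (2 * d + 1)) ^ 4 ≤ G) (hE : |E - Eb| ≤ 1 / G)
    (hin : ∀ n ∈ tSquare c r, |ψ n| ≤ B) :
    ∃ d', d ≤ d' ∧ d' < 2 * d ∧ ∀ n ∈ tSquare c (r + d' : ℕ), |ψ n| ≤ B * G ^ 2 := by
  have hr : 1 ≤ r := by omega
  have hr1 : (1 : ℝ) ≤ r := by exact_mod_cast hr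
  have hd1 : (1 : ℝ) ≤ d := by exact_mod_cast hd
  set A := {n | n ∈ Λ ∧ n ∉ F ∧ 1 < |ψ n|} ∩ tSquare c (2 * r : ℕ) with hA
  have hAfin : A.Finite := (finite_tSquare c _).subset Set.inter_subset_right
  obtain ⟨T, hT1, hT2, hT⟩ := exists_radius_ncard_outDiag_le hAfin c (r := r) hd
  refine ⟨T - r, by omega, by omega, ?_⟩
  have hG1 : 1 ≤ G := by
    refine le_trans (one_le_pow₀ (one_le_pow₀ ?_)) hG
    nlinarith
  refine abs_le_tSquare_add hB hG1 hr ?_ hin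
  intro k w hw1 hw2 B' hB' h0
  have hwR : (r : ℝ) ≤ w := by exact_mod_cast hw1
  have hmem : ∀ i < 2 * w + 1, ∀ j < T - r + 2, (i + j + (w + r + 1)) % 2 = 0 →
      stripSite c k w r i j ∈ tSquare c (2 * r : ℕ) := fun i hi j hj hv =>
    stripSite_mem_tSquare k hr hv hi (by omega) (by omega)
  set P := (D * (2 * w + 1 : ℕ)) ^ (T - r + 2) with hP
  have hPG : P ^ 4 ≤ G := by
    refine le_trans ?_ hG
    have hw3 : ((2 * w + 1 : ℕ) : ℝ) ≤ 4 * r + 1 := by exact_mod_cast (by omega : 2 * w + 1 ≤ 4 * r + 1)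
    have h1 : 1 ≤ D * (4 * r + 1) := by nlinarith
    calc P ^ 4 ≤ ((D * (4 * r + 1)) ^ (T - r + 2)) ^ 4 := by rw [hP]; gcongr
      _ ≤ _ := pow_le_pow_left₀ (by positivity) (pow_le_pow_right₀ h1 (by omega)) 4
  have hP1 : 0 < P ^ 4 := by
    have : 0 < D := by linarith
    positivity
  have hres := abs_le_of_stripGood hψ (c := c) (k := k) (w := w) (r := r) (b := T - r + 2)
    (P := P) (c₀ := c₀) (B := B') (fun i hi j hj hv => hΛ (hmem i hi j hj hv))
    (hgood k w _ hw1 (by omega) (by omega) (by omega))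
    (hE.trans (one_div_le_one_div_of_le hP1 hPG)) (by linarith) h0 ?_
  · intro i hi j hj hv
    exact (hres i hi j hj hv).trans (mul_le_mul_of_nonneg_left hPG (by linarith))
  intro j hj hjb
  have h1 := card_filter_frozen_le (c := c) k (w := w) (r := r) (j := j) (R := 2 * r) hr (by omega)
      (by omega) hε hF
  have h2 := card_filter_stripSite_le (c := c) k (w := w) (r := r) (j := j) (R := 2 * r) hr (by omega)
      (by omega) {n | n ∈ Λ ∧ n ∉ F ∧ 1 < |ψ n|}
  rw [← hA] at h2
  have h3 := hT k (j + r - 1) (by omega) (by omega)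
  have h4 : ((Finset.range (2 * w + 1)).filter fun i =>
      (i + j + (w + r + 1)) % 2 = 0 ∧ B' < |ψ (stripSite c k w r i j)|) ⊆
      ((Finset.range (2 * w + 1)).filter fun i =>
        (i + j + (w + r + 1)) % 2 = 0 ∧ stripSite c k w r i j ∈ F) ∪
      ((Finset.range (2 * w + 1)).filter fun i => (i + j + (w + r + 1)) % 2 = 0 ∧
        stripSite c k w r i j ∈ {n | n ∈ Λ ∧ n ∉ F ∧ 1 < |ψ n|}) := by
    intro i hi
    simp only [Finset.mem_union, Finset.mem_filter, Finset.mem_range, Set.mem_ofPred_eq] at hi ⊢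
    by_cases hiF : stripSite c k w r i j ∈ F
    · left; exact ⟨hi.1, hi.2.1, hiF⟩
    · right
      exact ⟨hi.1, hi.2.1, hΛ (hmem i hi.1 j (by omega) hi.2.1), hiF, by linarith [hi.2.2]⟩
  have h5 := (Finset.card_le_card h4).trans (Finset.card_union_le _ _)
  have h6 : ((((Finset.range (2 * w + 1)).filter fun i =>
      (i + j + (w + r + 1)) % 2 = 0 ∧ B' < |ψ (stripSite c k w r i j)|).card : ℕ) : ℝ)
      ≤ ε * (2 * (2 * r : ℕ) + 1) + ((A ∩ outDiag c k (j + r - 1)).ncard : ℝ) := by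
    refine le_trans (Nat.cast_le.mpr h5) ?_
    push_cast
    push_cast at h1
    have : ((((Finset.range (2 * w + 1)).filter fun i => (i + j + (w + r + 1)) % 2 = 0 ∧
        stripSite c k w r i j ∈ {n | n ∈ Λ ∧ n ∉ F ∧ 1 < |ψ n|}).card : ℕ) : ℝ)
        ≤ ((A ∩ outDiag c k (j + r - 1)).ncard : ℝ) := by exact_mod_cast h2
    linarith
  refine h6.trans ?_
  push_cast at hbad ⊢
  have h7 : (d : ℝ) * ((A ∩ outDiag c k (j + r - 1)).ncard : ℝ) ≤ d * (c₀ * r) := by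
    calc _ ≤ 8 * (τ * (2 * (2 * r) + 1) ^ 2) := by linarith
      _ ≤ 200 * τ * r * r := by
        have : (2 * (2 * (r : ℝ)) + 1) ^ 2 ≤ 25 * r ^ 2 := by nlinarith
        nlinarith
      _ ≤ c₀ * d * r := by gcongr
      _ = _ := by ring
  have h8 := le_of_mul_le_mul_left h7 (by linarith)
  nlinarith

lemma mem_tSquare_self (c : ℤ × ℤ) (R : ℕ) : c ∈ tSquare c R := by
  simp only [tSquare, tRect, Set.mem_ofPred_eq]
  omega

lemma ncard_tSquare_le (c : ℤ × ℤ) (R : ℕ) : (tSquare c R).ncard ≤ (2 * R + 1) ^ 2 := by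
  have h : (tSquare c R).ncard ≤ (Finset.Icc (-(R : ℤ)) R ×ˢ Finset.Icc (-(R : ℤ)) R :
      Finset (ℤ × ℤ)).card := by
    rw [← Set.ncard_coe_finset]
    refine Set.ncard_le_ncard_of_injOn
      (fun n => (n.1 + n.2 - (c.1 + c.2), n.1 - n.2 - (c.1 - c.2))) ?_ ?_ (Finset.finite_toSet _)
    · intro n hn
      simp only [tSquare, tRect, Set.mem_ofPred_eq] at hn
      simp only [Finset.coe_product, Finset.coe_Icc, Set.mem_prod, Set.mem_Icc]
      omega
    · rintro ⟨x, y⟩ hn ⟨x', y'⟩ hn' h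
      simp only [Prod.mk.injEq] at h ⊢
      omega
  refine h.trans (le_of_eq ?_)
  rw [Finset.card_product, Int.card_Icc, sq]
  congr 1 <;> omega

lemma sq_le_nine_mul_ncard_tSquare (c : ℤ × ℤ) (R : ℕ) :
    (2 * R + 1) ^ 2 ≤ 9 * (tSquare c R).ncard := by
  set h := R / 2 with hh
  have h1 : (Finset.Icc (c.1 - (h : ℤ)) (c.1 + h) ×ˢ Finset.Icc (c.2 - (h : ℤ)) (c.2 + h) :
      Finset (ℤ × ℤ)).card ≤ (tSquare c R).ncard := by
    rw [← Set.ncard_coe_finset]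
    refine Set.ncard_le_ncard ?_ (finite_tSquare c R)
    intro n hn
    simp only [Finset.coe_product, Finset.coe_Icc, Set.mem_prod, Set.mem_Icc] at hn
    simp only [tSquare, tRect, Set.mem_ofPred_eq]
    omega
  have h2 : (Finset.Icc (c.1 - (h : ℤ)) (c.1 + h) ×ˢ Finset.Icc (c.2 - (h : ℤ)) (c.2 + h) :
      Finset (ℤ × ℤ)).card = (2 * h + 1) ^ 2 := by
    rw [Finset.card_product, Int.card_Icc, Int.card_Icc, sq]
    congr 1 <;> omega
  have h3 : 2 * R + 1 ≤ 3 * (2 * h + 1) := by omega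
  calc (2 * R + 1) ^ 2 ≤ (3 * (2 * h + 1)) ^ 2 := Nat.pow_le_pow_left h3 2
    _ = 9 * (2 * h + 1) ^ 2 := by ring
    _ ≤ _ := by omega

/-- A Vitali covering lemma for tilted squares. -/
lemma exists_disjoint_tSquare (X : Finset (ℤ × ℤ)) (R : ℤ × ℤ → ℕ) :
    ∃ U ⊆ X, (U : Set (ℤ × ℤ)).PairwiseDisjoint (fun x => tSquare x (R x)) ∧
      X.card ≤ 9 * ∑ x ∈ U, (2 * R x + 1) ^ 2 := by
  obtain ⟨u, huX, hud, hu⟩ := Vitali.exists_disjoint_subfamily_covering_enlargement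
    (fun x : ℤ × ℤ => tSquare x (R x)) (X : Set (ℤ × ℤ)) (fun x => (R x : ℝ)) 2 (by norm_num)
    (fun _ _ => Nat.cast_nonneg _) (∑ x ∈ X, (R x : ℝ))
    (fun x hx => Finset.single_le_sum (f := fun x => (R x : ℝ))
      (fun _ _ => Nat.cast_nonneg _) hx)
    (fun x _ => ⟨x, mem_tSquare_self x _⟩)
  have huf : u.Finite := X.finite_toSet.subset huX
  refine ⟨huf.toFinset, fun x hx => huX (huf.mem_toFinset.mp hx), by simpa using hud, ?_⟩
  have hcov : X ⊆ huf.toFinset.biUnion fun x => (finite_tSquare x (3 * R x : ℕ)).toFinset := by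
    intro x hx
    obtain ⟨y, hy, ⟨n, hn⟩, hR⟩ := hu x hx
    have hR' : R x ≤ 2 * R y := by exact_mod_cast hR
    simp only [Finset.mem_biUnion, Set.Finite.mem_toFinset]
    refine ⟨y, hy, ?_⟩
    simp only [tSquare, tRect, Set.mem_inter_iff, Set.mem_ofPred_eq] at hn ⊢
    push_cast
    omega
  refine (Finset.card_le_card hcov).trans (Finset.card_biUnion_le.trans ?_)
  rw [Finset.mul_sum]
  refine Finset.sum_le_sum fun x _ => ?_
  rw [← Set.ncard_eq_toFinset_card _ (finite_tSquare x _)]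
  refine (ncard_tSquare_le x _).trans ?_
  calc (2 * (3 * R x) + 1) ^ 2 ≤ (3 * (2 * R x + 1)) ^ 2 := Nat.pow_le_pow_left (by omega) 2
    _ = _ := by ring

lemma isTiltedSquare_tSquare (c : ℤ × ℤ) (R : ℕ) : IsTiltedSquare (tSquare c R) := by
  refine ⟨c.1 + c.2 - R, c.1 - c.2 - R, 2 * R + 1, by omega, ?_⟩
  unfold tSquare
  congr 1 <;> push_cast <;> ring

lemma sum_ncard_inter_tSquare_le {A : Set (ℤ × ℤ)} (hA : A.Finite) {U : Finset (ℤ × ℤ)}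
    {R : ℤ × ℤ → ℕ} (hU : (U : Set (ℤ × ℤ)).PairwiseDisjoint (fun x => tSquare x (R x))) :
    ∑ x ∈ U, (A ∩ tSquare x (R x)).ncard ≤ A.ncard := by
  have hfin : ∀ x, (A ∩ tSquare x (R x)).Finite := fun x => hA.subset Set.inter_subset_left
  have h1 : ∑ x ∈ U, (A ∩ tSquare x (R x)).ncard
      = (U.biUnion fun x => (hfin x).toFinset).card := by
    rw [Finset.card_biUnion]
    · exact Finset.sum_congr rfl fun x _ => Set.ncard_eq_toFinset_card _ (hfin x)
    · intro x hx y hy hxy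
      refine Set.Finite.disjoint_toFinset.mpr ?_
      exact (hU hx hy hxy).mono Set.inter_subset_right Set.inter_subset_right
  rw [h1, ← Set.ncard_coe_finset]
  refine Set.ncard_le_ncard ?_ hA
  intro n hn
  simp only [Finset.coe_biUnion, Set.mem_iUnion, Set.Finite.coe_toFinset] at hn
  obtain ⟨_, _, hn⟩ := hn
  exact hn.1

lemma RegularIn.sum_le {ε : ℝ} {F : Set (ℤ × ℤ)} {Λ : Finset (ℤ × ℤ)} (hF : RegularIn ε F Λ)
    {U : Finset (ℤ × ℤ)} {R : ℤ × ℤ → ℕ}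
    (hU : (U : Set (ℤ × ℤ)).PairwiseDisjoint (fun x => tSquare x (R x)))
    (hsub : ∀ x ∈ U, tSquare x (R x) ⊆ Λ) (hns : ∀ x ∈ U, ¬ SparseIn ε F (tSquare x (R x))) :
    ((∑ x ∈ U, (2 * R x + 1) ^ 2 : ℕ) : ℝ) ≤ 9 * (ε * Λ.card) := by
  have h1 := hF U.card (fun i => tSquare (U.equivFin.symm i : ℤ × ℤ) (R (U.equivFin.symm i)))
    (fun i => isTiltedSquare_tSquare _ _) (fun i => hsub _ (U.equivFin.symm i).2)
    (fun i j hij => hU (U.equivFin.symm i).2 (U.equivFin.symm j).2 (by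
      intro h
      exact hij (U.equivFin.symm.injective (Subtype.ext h))))
    (fun i => hns _ (U.equivFin.symm i).2)
  have hfin : (⋃ i, tSquare (U.equivFin.symm i : ℤ × ℤ) (R (U.equivFin.symm i))).Finite :=
    Set.finite_iUnion fun i => finite_tSquare _ _
  have h2 := sum_ncard_inter_tSquare_le hfin hU
  have h3 : ∑ x ∈ U, (2 * R x + 1) ^ 2 ≤ 9 *
      (⋃ i, tSquare (U.equivFin.symm i : ℤ × ℤ) (R (U.equivFin.symm i))).ncard := by
    refine le_trans ?_ (Nat.mul_le_mul_left 9 h2)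
    rw [Finset.mul_sum]
    refine Finset.sum_le_sum fun x hx => ?_
    rw [Set.inter_eq_self_of_subset_right]
    · exact sq_le_nine_mul_ncard_tSquare x _
    · intro n hn
      refine Set.mem_iUnion.mpr ⟨U.equivFin ⟨x, hx⟩, ?_⟩
      simpa using hn
  have h4 : ((∑ x ∈ U, (2 * R x + 1) ^ 2 : ℕ) : ℝ) ≤ 9 *
      ((⋃ i, tSquare (U.equivFin.symm i : ℤ × ℤ) (R (U.equivFin.symm i))).ncard : ℕ) := by
    exact_mod_cast h3
  rw [Set.ncard_coe_finset] at h1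
  linarith

/-- A large set contains a point around which a regular set and a small set are both sparse, at all
scales. -/
lemma exists_sparse_point {ε τ : ℝ} {F A : Set (ℤ × ℤ)} {Λ N : Finset (ℤ × ℤ)} {m : ℕ}
    (hF : RegularIn ε F Λ) (hA : A.Finite) (hτ : 0 < τ) (hN : ∀ x ∈ N, tSquare x m ⊆ Λ)
    (hcard : 81 * (ε * Λ.card) + 9 * (A.ncard / τ) < N.card) :
    ∃ x ∈ N, ∀ R ≤ m, SparseIn ε F (tSquare x R) ∧
      ((A ∩ tSquare x R).ncard : ℝ) ≤ τ * (2 * R + 1) ^ 2 := by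
  by_contra! hcon
  set X₁ := N.filter fun x => ∃ R ≤ m, ¬ SparseIn ε F (tSquare x R) with hX₁
  set X₂ := N.filter fun x => ∃ R ≤ m, τ * (2 * R + 1) ^ 2 < ((A ∩ tSquare x R).ncard : ℝ) with hX₂
  have hNX : N ⊆ X₁ ∪ X₂ := by
    intro x hx
    obtain ⟨R, hR, h⟩ := hcon x hx
    rw [Finset.mem_union, hX₁, hX₂, Finset.mem_filter, Finset.mem_filter]
    by_cases hs : SparseIn ε F (tSquare x R)
    · exact Or.inr ⟨hx, R, hR, h hs⟩
    · exact Or.inl ⟨hx, R, hR, hs⟩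
  have hcardN : (N.card : ℝ) ≤ X₁.card + X₂.card := by
    exact_mod_cast (Finset.card_le_card hNX).trans (Finset.card_union_le _ _)
  have h₁ : (X₁.card : ℝ) ≤ 81 * (ε * Λ.card) := by
    have hex : ∀ x ∈ X₁, ∃ R ≤ m, ¬ SparseIn ε F (tSquare x R) :=
      fun x hx => (Finset.mem_filter.mp hx).2
    choose! R hR using hex
    obtain ⟨U, hU, hUd, hc⟩ := exists_disjoint_tSquare X₁ R
    have hs := hF.sum_le hUd (fun x hx => Set.Subset.trans (by
      have := (hR x (hU hx)).1
      intro n hn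
      simp only [tSquare, tRect, Set.mem_ofPred_eq] at hn ⊢
      omega) (hN x (Finset.mem_filter.mp (hU hx)).1)) (fun x hx => (hR x (hU hx)).2)
    have hc' : (X₁.card : ℝ) ≤ 9 * ((∑ x ∈ U, (2 * R x + 1) ^ 2 : ℕ) : ℝ) := by exact_mod_cast hc
    linarith
  have h₂ : (X₂.card : ℝ) ≤ 9 * (A.ncard / τ) := by
    have hex : ∀ x ∈ X₂, ∃ R : ℕ, R ≤ m ∧ τ * (2 * R + 1) ^ 2 < ((A ∩ tSquare x R).ncard : ℝ) :=
      fun x hx => (Finset.mem_filter.mp hx).2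
    choose! R hR using hex
    obtain ⟨U, hU, hUd, hc⟩ := exists_disjoint_tSquare X₂ R
    have hs := sum_ncard_inter_tSquare_le hA hUd
    have hs' : (∑ x ∈ U, ((A ∩ tSquare x (R x)).ncard : ℝ)) ≤ A.ncard := by exact_mod_cast hs
    have hle : τ * ∑ x ∈ U, (2 * (R x : ℝ) + 1) ^ 2 ≤ A.ncard := by
      rw [Finset.mul_sum]
      exact le_trans (Finset.sum_le_sum fun x hx => (hR x (hU hx)).2.le) hs'
    have hc' : (X₂.card : ℝ) ≤ 9 * ∑ x ∈ U, (2 * (R x : ℝ) + 1) ^ 2 := by exact_mod_cast hc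
    have : ∑ x ∈ U, (2 * (R x : ℝ) + 1) ^ 2 ≤ A.ncard / τ := by
      rw [le_div_iff₀ hτ]; linarith
    linarith
  linarith

/-- The choice of the thickness of the layer by which a bound is extended. -/
lemma exists_layer_thickness {c₀ X : ℝ} (hc : 0 < c₀) (hc1 : c₀ ≤ 1 / 64) (hX : 1 ≤ Real.log X)
    {r : ℕ} (hr : 9 * Real.log X ≤ c₀ * r) (hrX : (r : ℝ) ≤ X) :
    ∃ d : ℕ, 1 ≤ d ∧ 2 * d ≤ r ∧ 9 * (d : ℝ) ^ 2 * Real.log X ≤ c₀ * r ∧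
      200 * (c₀ ^ 2 / 1200 / Real.sqrt (X * Real.log X)) * r ≤ c₀ * d ∧
      d * Real.log X ≤ Real.sqrt (X * Real.log X) := by
  set l := Real.log X with hl
  have hr0 : (0 : ℝ) < r := by
    by_contra h
    nlinarith
  have hX0 : 0 < X := hr0.trans_le hrX
  set z := c₀ * r / (9 * l) with hz
  have hz1 : 1 ≤ z := by rw [hz, one_le_div (by linarith)]; exact hr
  have hzl : z * (9 * l) = c₀ * r := by rw [hz]; field_simp
  set d := ⌊Real.sqrt z⌋₊ with hd
  have hd1 : 1 ≤ d := Nat.le_floor (by simpa using Real.one_le_sqrt.mpr hz1)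
  have hd1' : (1 : ℝ) ≤ d := by exact_mod_cast hd1
  have hdz : (d : ℝ) ^ 2 ≤ z := by
    rw [← Real.sq_sqrt (by linarith : 0 ≤ z)]
    exact pow_le_pow_left₀ (by linarith) (Nat.floor_le (Real.sqrt_nonneg z)) 2
  have hzd : z ≤ 4 * (d : ℝ) ^ 2 := by
    have h1 := (Nat.lt_floor_add_one (Real.sqrt z)).le
    have h2 : Real.sqrt z ≤ 2 * d := by linarith
    calc z = Real.sqrt z ^ 2 := (Real.sq_sqrt (by linarith)).symm
      _ ≤ (2 * d) ^ 2 := pow_le_pow_left₀ (Real.sqrt_nonneg z) h2 2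
      _ = _ := by ring
  have hdl : 9 * (d : ℝ) ^ 2 * l ≤ c₀ * r := by nlinarith
  refine ⟨d, hd1, ?_, hdl, ?_, ?_⟩
  · have : (2 : ℝ) * d ≤ r := by
      have h1 : 9 * (d : ℝ) ≤ 9 * (d : ℝ) ^ 2 * l := by
        have : (d : ℝ) ≤ (d : ℝ) ^ 2 := by nlinarith
        nlinarith
      nlinarith
    exact_mod_cast this
  · refine abs_le_of_sq_le_sq' ?_ (by positivity) |>.2
    have hs : Real.sqrt (X * l) ^ 2 = X * l := Real.sq_sqrt (by positivity)
    have h1 : (200 * (c₀ ^ 2 / 1200 / Real.sqrt (X * l)) * r) ^ 2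
        = c₀ ^ 4 / 36 * (r ^ 2 / (X * l)) := by
      rw [mul_pow, mul_pow, div_pow, div_pow, hs]
      field_simp
      ring
    have h2 : (r : ℝ) ^ 2 / (X * l) ≤ r / l := by
      rw [div_le_div_iff₀ (by positivity) (by positivity)]
      have : (r : ℝ) * r ≤ r * X := by gcongr
      nlinarith [mul_le_mul_of_nonneg_right this (by linarith : 0 ≤ l)]
    have h3 : c₀ * (r / l) ≤ 36 * (d : ℝ) ^ 2 := by
      have : c₀ * (r / l) = 9 * z := by rw [hz]; field_simp
      linarith
    rw [h1]
    calc c₀ ^ 4 / 36 * (r ^ 2 / (X * l)) ≤ c₀ ^ 4 / 36 * (r / l) := by gcongr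
      _ = c₀ ^ 3 / 36 * (c₀ * (r / l)) := by ring
      _ ≤ c₀ ^ 3 / 36 * (36 * (d : ℝ) ^ 2) := by gcongr
      _ = c₀ * (c₀ * d) ^ 2 := by ring
      _ ≤ 1 * (c₀ * d) ^ 2 := by gcongr; linarith
      _ = _ := one_mul _
  · apply Real.le_sqrt_of_sq_le
    have : (d : ℝ) ^ 2 * l ≤ X := by nlinarith [mul_nonneg (sq_nonneg (d : ℝ)) (by linarith : 0 ≤ l)]
    nlinarith

/-- A bound near `c` propagates, when the radius can always be increased at a controlled cost. -/
lemma exists_abs_le_pow_tSquare {ψ : ℤ × ℤ → ℝ} {c : ℤ × ℤ} {m : ℕ} {X : ℝ} (hm : 1 ≤ m)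
    (hX : 1 ≤ X) (h1 : ∀ n ∈ tSquare c (1 : ℕ), |ψ n| ≤ 1)
    (hstep : ∀ (r : ℕ) (B : ℝ), 1 ≤ r → r < m → 1 ≤ B → (∀ n ∈ tSquare c r, |ψ n| ≤ B) →
      ∃ d, 1 ≤ d ∧ d ≤ r ∧ ∀ n ∈ tSquare c (r + d : ℕ), |ψ n| ≤ B * X ^ (48 * d)) :
    ∃ r, m ≤ r ∧ ∀ n ∈ tSquare c r, |ψ n| ≤ X ^ (96 * m) := by
  suffices h : ∀ k r : ℕ, 1 ≤ r → r ≤ 2 * m → m ≤ r + k →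
      (∀ n ∈ tSquare c r, |ψ n| ≤ X ^ (48 * r)) →
      ∃ r, m ≤ r ∧ ∀ n ∈ tSquare c r, |ψ n| ≤ X ^ (96 * m) from
    h m 1 le_rfl (by omega) (by omega) fun n hn => (h1 n hn).trans (one_le_pow₀ hX)
  intro k
  induction k with
  | zero =>
    intro r _ hr hmr hb
    exact ⟨r, by omega, fun n hn => (hb n hn).trans (pow_le_pow_right₀ hX (by omega))⟩
  | succ k ih =>
    intro r hr1 hr hmr hb
    rcases le_or_gt m r with hmr' | hmr'
    · exact ⟨r, hmr', fun n hn => (hb n hn).trans (pow_le_pow_right₀ hX (by omega))⟩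
    · obtain ⟨d, hd, hdr, h⟩ := hstep r _ hr1 hmr' (one_le_pow₀ hX) hb
      refine ih (r + d) (by omega) (by omega) (by omega) fun n hn => (h n hn).trans (le_of_eq ?_)
      rw [← pow_add]
      ring_nf

/-- All strips whose frozen sites are sparse are good. -/
def StripsGood (Λ : Finset (ℤ × ℤ)) (F : Set (ℤ × ℤ)) (v : ℤ × ℤ → ℝ)
    (W : (Λ.filter (· ∉ F) : Finset (ℤ × ℤ)) → ℝ) (ε c₀ D Eb X q : ℝ) : Prop :=
  ∀ c ∈ Λ, ∀ (k : Bool × Bool) (r w b : ℕ), q ≤ r → 4 * r + 1 ≤ X → r ≤ w → w ≤ 2 * r → 1 ≤ b →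
    b ≤ r + 2 → 2 * (b : ℝ) ^ 2 * Real.log X ≤ c₀ * (2 * w + 1) → tSquare c (2 * r : ℕ) ⊆ Λ →
    SparseIn ε F (tSquare c (2 * r : ℕ)) →
      StripGood (2 * w + 1) b (w + r + 1) ((D * (2 * w + 1 : ℕ)) ^ b) Eb c₀
        (chartPot (freeSite (Λ.filter (· ∉ F)) c k w r) (frozenPot F v c k w r) W)

lemma eq_empty_of_ncard_lt_one {A : Set (ℤ × ℤ)} (hA : A.Finite) (h : (A.ncard : ℝ) < 1) :
    A = ∅ := by
  rw [← Set.ncard_eq_zero hA]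
  have : A.ncard < 1 := by exact_mod_cast h
  omega

/-- One step of the growth of a bound around a point at which the frozen and the exceptional sites
are sparse at all scales. -/
lemma exists_growth_step {Λ : Finset (ℤ × ℤ)} {F : Set (ℤ × ℤ)} {v : ℤ × ℤ → ℝ}
    {W : (Λ.filter (· ∉ F) : Finset (ℤ × ℤ)) → ℝ} {E Eb : ℝ} {ψ : ℤ × ℤ → ℝ}
    (hψ : EigOn (fun n => if n ∈ F then v n else extV (Λ.filter (· ∉ F)) W n) E ψ Λ)
    {K c₀ ε D X q B : ℝ} (hK : 0 ≤ K)
    (hV : ∀ n ∈ Λ, |4 + (if n ∈ F then v n else extV (Λ.filter (· ∉ F)) W n) - E| ≤ K)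
    (hc : 0 < c₀) (hc1 : c₀ ≤ 1 / 64) (hε : 0 ≤ ε) (hεc : 4 * ε ≤ c₀) (hD : 1 ≤ D) (hDX : D ≤ X)
    (hX : 1 ≤ Real.log X) (hq : 0 < q) (hqX : q ^ 4 = X) (hlog : 9 * Real.log X ≤ c₀ * q)
    (hKX : 1 + (2 * q + 3) * (K + 2) ≤ X)
    (hE : |E - Eb| ≤ Real.exp (-24 * Real.sqrt (X * Real.log X)))
    (hS : StripsGood Λ F v W ε c₀ D Eb X q) {c : ℤ × ℤ} {r : ℕ} (hr : 1 ≤ r)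
    (hrX : 4 * r + 1 ≤ X) (hB : 1 ≤ B) (hΛ : tSquare c (2 * r : ℕ) ⊆ Λ)
    (hF : SparseIn ε F (tSquare c (2 * r : ℕ)))
    (hbad : (({n | n ∈ Λ ∧ n ∉ F ∧ 1 < |ψ n|} ∩ tSquare c (2 * r : ℕ)).ncard : ℝ)
      ≤ c₀ ^ 2 / 1200 / Real.sqrt (X * Real.log X) * (2 * (2 * r : ℕ) + 1) ^ 2)
    (hin : ∀ n ∈ tSquare c r, |ψ n| ≤ B) :
    ∃ d, 1 ≤ d ∧ d ≤ r ∧ ∀ n ∈ tSquare c (r + d : ℕ), |ψ n| ≤ B * X ^ (48 * d) := by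
  have hX0 : 0 < X := by rw [← hqX]; positivity
  have hX1 : 1 ≤ X := hD.trans hDX
  have hr0 : (1 : ℝ) ≤ r := by exact_mod_cast hr
  rcases lt_or_ge (r : ℝ) q with hrq | hrq
  · refine ⟨1, le_rfl, hr, fun n hn => ?_⟩
    have hsqrt : q ^ 2 ≤ Real.sqrt (X * Real.log X) := by
      apply Real.le_sqrt_of_sq_le
      calc (q ^ 2) ^ 2 = X * 1 := by rw [← hqX]; ring
        _ ≤ X * Real.log X := by gcongr
    have hone : ∀ n ∈ tSquare c (2 * r : ℕ), n ∉ F → |ψ n| ≤ 1 := by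
      have hempty := eq_empty_of_ncard_lt_one
        ((finite_tSquare c (2 * r : ℕ)).subset Set.inter_subset_right) (lt_of_le_of_lt hbad ?_)
      · intro n hn hnF
        by_contra h
        have : n ∈ {n | n ∈ Λ ∧ n ∉ F ∧ 1 < |ψ n|} ∩ tSquare c (2 * r : ℕ) :=
          ⟨⟨hΛ hn, hnF, not_le.mp h⟩, hn⟩
        rw [hempty] at this
        exact this
      · have h0 : 0 < Real.sqrt (X * Real.log X) := lt_of_lt_of_le (by positivity) hsqrt
        rw [div_mul_eq_mul_div, div_lt_one h0]
        push_cast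
        have h1 : (2 * (2 * (r : ℝ)) + 1) ^ 2 ≤ 25 * q ^ 2 := by nlinarith
        have h2 : c₀ ^ 2 / 1200 < 1 / 50 := by nlinarith
        calc c₀ ^ 2 / 1200 * (2 * (2 * (r : ℝ)) + 1) ^ 2 ≤ 1 / 50 * (25 * q ^ 2) := by gcongr
          _ < q ^ 2 := by nlinarith [pow_pos hq 2]
          _ ≤ _ := hsqrt
    refine (abs_le_tSquare_succ hψ hK hV hε (by linarith) hB hr (G := X) ?_ hΛ hF hone hin n
      hn).trans ?_
    · refine le_trans ?_ hKX
      gcongr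
    · exact mul_le_mul_of_nonneg_left (pow_le_pow_right₀ hX1 (by norm_num)) (by linarith)
  · obtain ⟨d, hd, hdr, hdl, hτ, hdE⟩ := exists_layer_thickness hc hc1 hX
      (hlog.trans (mul_le_mul_of_nonneg_left hrq hc.le)) (by linarith : (r : ℝ) ≤ X)
    have hd1 : (1 : ℝ) ≤ d := by exact_mod_cast hd
    have hcΛ : c ∈ Λ := hΛ (mem_tSquare_self c _)
    have hlayer := exists_abs_le_tSquare_add hψ (D := D) (G := X ^ (24 * d)) (Eb := Eb)
      hε hεc hB hD hd hdr (by positivity) hτ hΛ hF hbad ?_ ?_ ?_ hin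
    · obtain ⟨d', hd', hd'2, h⟩ := hlayer
      refine ⟨d', by omega, by omega, fun n hn => (h n hn).trans ?_⟩
      rw [← pow_mul]
      exact mul_le_mul_of_nonneg_left (pow_le_pow_right₀ hX1 (by omega)) (by linarith)
    · intro k w b hw1 hw2 hb1 hb2
      refine hS c hcΛ k r w b hrq hrX hw1 hw2 (by omega) (by omega) ?_ hΛ hF
      have h1 : (b : ℝ) ≤ 3 * d := by exact_mod_cast (by omega : b ≤ 3 * d)
      have h2 : (b : ℝ) ^ 2 ≤ (3 * d) ^ 2 := by gcongr
      have h3 : (r : ℝ) ≤ w := by exact_mod_cast hw1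
      have h4 : (b : ℝ) ^ 2 * Real.log X ≤ (3 * d) ^ 2 * Real.log X := by gcongr
      nlinarith
    · have h1 : D * (4 * r + 1) ≤ X ^ 2 := by rw [sq]; gcongr
      calc ((D * (4 * r + 1)) ^ (2 * d + 1)) ^ 4 ≤ ((X ^ 2) ^ (2 * d + 1)) ^ 4 := by gcongr
        _ = X ^ (16 * d + 8) := by rw [← pow_mul, ← pow_mul]; ring_nf
        _ ≤ X ^ (24 * d) := pow_le_pow_right₀ hX1 (by omega)
    · refine hE.trans ?_
      rw [one_div, ← Real.exp_log (pow_pos hX0 _), ← Real.exp_neg, Real.exp_le_exp, Real.log_pow]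
      push_cast
      linarith

lemma measure_not_stripsGood_le (μ : ℤ × ℤ → Measure ℝ) [∀ n, IsProbabilityMeasure (μ n)]
    {M γ₀ ρ : ℝ} (hM : 0 ≤ M) (hγ : 0 < γ₀) (hρ : 0 < ρ) (hρ1 : ρ ≤ 1)
    (hsupp : ∀ n, μ n (Set.Icc 0 M) = 1)
    (hac : ∀ n, ∀ t ∈ Set.Icc (0 : ℝ) M, ENNReal.ofReal ρ ≤ μ n {s | γ₀ / 2 < |s - t|})
    {Eb : ℝ} (hEb : Eb ∈ Set.Icc 0 (8 + M)) {D : ℝ} (hD : 4 * (M + 9) + 8 / γ₀ ≤ D)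
    {c₀ ε q : ℝ} (hc : c₀ = ρ / 64) (hε : 0 ≤ ε) (hεc : 4 * ε ≤ c₀) (hq : 8 ≤ q)
    {Λ : Finset (ℤ × ℤ)} {L : ℕ} (hΛ : Λ.card = L ^ 2) (hDL : D ≤ L)
    (hlog : 9 * Real.log L ≤ c₀ * q) (F : Set (ℤ × ℤ)) {v : ℤ × ℤ → ℝ}
    (hv : ∀ n ∈ F, v n ∈ Set.Icc (0 : ℝ) M) :
    Measure.pi (fun n : (Λ.filter (· ∉ F) : Finset (ℤ × ℤ)) => μ n.1)
      {W | ¬ StripsGood Λ F v W ε c₀ D Eb L q} ≤ ENNReal.ofReal (Real.exp (-c₀ * q)) := by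
  have hc0 : 0 < c₀ := by rw [hc]; positivity
  have hγ' : 0 < 8 / γ₀ := by positivity
  have hD4 : 36 ≤ D := by linarith
  have hL4 : (36 : ℝ) ≤ L := hD4.trans hDL
  set J : Finset ((ℤ × ℤ) × (Bool × Bool) × ℕ × ℕ × ℕ) :=
    Λ ×ˢ Finset.univ ×ˢ Finset.range L ×ˢ Finset.range L ×ˢ Finset.range L with hJ
  have hJcard : J.card = 4 * L ^ 5 := by
    simp only [hJ, Finset.card_product, hΛ, Finset.card_range, Finset.card_univ, Fintype.card_prod,
      Fintype.card_bool]
    ring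
  set P : (ℤ × ℤ) × (Bool × Bool) × ℕ × ℕ × ℕ → Prop := fun ⟨c, _, r, w, b⟩ =>
    q ≤ r ∧ 4 * (r : ℝ) + 1 ≤ L ∧ r ≤ w ∧ w ≤ 2 * r ∧ 1 ≤ b ∧ b ≤ r + 2 ∧
      2 * (b : ℝ) ^ 2 * Real.log L ≤ c₀ * (2 * w + 1) ∧ tSquare c (2 * r : ℕ) ⊆ Λ ∧
      SparseIn ε F (tSquare c (2 * r : ℕ)) with hP
  set S : (ℤ × ℤ) × (Bool × Bool) × ℕ × ℕ × ℕ →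
      Set ((Λ.filter (· ∉ F) : Finset (ℤ × ℤ)) → ℝ) := fun ⟨c, k, r, w, b⟩ =>
    {W | ¬ StripGood (2 * w + 1) b (w + r + 1) ((D * (2 * w + 1 : ℕ)) ^ b) Eb c₀
        (chartPot (freeSite (Λ.filter (· ∉ F)) c k w r) (frozenPot F v c k w r) W)} with hS
  have hsub : {W | ¬ StripsGood Λ F v W ε c₀ D Eb L q} ⊆ ⋃ j ∈ J.filter P, S j := by
    intro W hW
    simp only [StripsGood, Set.mem_ofPred_eq] at hW
    push Not at hW
    obtain ⟨c, hcΛ, k, r, w, b, h1, h2, h3, h4, h5, h6, h7, h8, h9, h10⟩ := hW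
    refine Set.mem_biUnion (x := (c, k, r, w, b)) ?_ h10
    have h2' : 4 * r + 1 ≤ L := by exact_mod_cast h2
    have hr : 8 ≤ r := by exact_mod_cast hq.trans h1
    simp only [Finset.coe_filter, Set.mem_ofPred_eq, hJ, Finset.mem_product, Finset.mem_univ,
      Finset.mem_range]
    exact ⟨⟨hcΛ, trivial, by omega, by omega, by omega⟩, h1, h2, h3, h4, h5, h6, h7, h8, h9⟩
  have hone : ∀ j ∈ J.filter P,
      Measure.pi (fun n : (Λ.filter (· ∉ F) : Finset (ℤ × ℤ)) => μ n.1) (S j) ≤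
        ENNReal.ofReal (Real.exp (-(2 * c₀ * q))) := by
    rintro ⟨c, k, r, w, b⟩ hj
    obtain ⟨h1, h2, h3, h4, h5, h6, h7, h8, h9⟩ := (Finset.mem_filter.mp hj).2
    have hr : 8 ≤ r := by exact_mod_cast hq.trans h1
    have h3' : (r : ℝ) ≤ w := by exact_mod_cast h3
    have h4' : (w : ℝ) ≤ 2 * r := by exact_mod_cast h4
    refine (measure_not_stripGood_le (fun n : (Λ.filter (· ∉ F) : Finset (ℤ × ℤ)) => μ n.1) hγ hρ hρ1
      (fun n => hsupp n) (fun n => hac n) hEb hD (by omega) h5 rfl hc ?_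
      freeSite_injective (frozenPot_mem hM hv c k w r) ?_).trans ?_
    · have : D * (2 * w + 1 : ℕ) ≤ (L : ℝ) ^ 2 := by
        rw [sq]
        have : ((2 * w + 1 : ℕ) : ℝ) ≤ L := by push_cast; linarith
        gcongr
      have h0 : (0 : ℝ) < D * (2 * w + 1 : ℕ) := by positivity
      calc (b : ℝ) ^ 2 * Real.log (D * (2 * w + 1 : ℕ)) ≤ (b : ℝ) ^ 2 * Real.log ((L : ℝ) ^ 2) := by
            gcongr
        _ = 2 * (b : ℝ) ^ 2 * Real.log L := by rw [Real.log_pow]; push_cast; ring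
        _ ≤ _ := by push_cast; exact h7
    · intro j hj
      have hcount := card_filter_frozen_le (c := c) k (w := w) (r := r) (j := j) (R := 2 * r)
        (by omega) h4 (by omega) hε h9
      refine le_trans (Nat.cast_le.mpr (Finset.card_le_card ?_)) (hcount.trans ?_)
      · intro i hi
        rw [Finset.mem_filter, Finset.mem_range] at hi ⊢
        refine ⟨hi.1, hi.2.1, ?_⟩
        by_contra hiF
        have hmem := h8 (stripSite_mem_tSquare (c := c) k (by omega) hi.2.1 hi.1 h4
          (by omega : j + r ≤ 2 * r + 1))
        have hnone := hi.2.2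
        unfold freeSite at hnone
        rw [dif_pos ⟨hi.2.1, Finset.mem_filter.mpr ⟨hmem, hiF⟩⟩] at hnone
        exact absurd hnone (by simp)
      · push_cast
        nlinarith
    · apply ENNReal.ofReal_le_ofReal
      rw [Real.exp_le_exp]
      push_cast
      nlinarith
  calc _ ≤ ∑ j ∈ J.filter P,
        Measure.pi (fun n : (Λ.filter (· ∉ F) : Finset (ℤ × ℤ)) => μ n.1) (S j) :=
        (measure_mono hsub).trans (measure_biUnion_finset_le _ _)
    _ ≤ (J.filter P).card • ENNReal.ofReal (Real.exp (-(2 * c₀ * q))) :=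
        Finset.sum_le_card_nsmul _ _ _ hone
    _ ≤ ((4 * L ^ 5 : ℕ) : ENNReal) * ENNReal.ofReal (Real.exp (-(2 * c₀ * q))) := by
        rw [nsmul_eq_mul]
        gcongr
        rw [← hJcard]
        exact Finset.card_filter_le _ _
    _ = ENNReal.ofReal (((4 * L ^ 5 : ℕ) : ℝ) * Real.exp (-(2 * c₀ * q))) := by
        rw [ENNReal.ofReal_mul (Nat.cast_nonneg _), ENNReal.ofReal_natCast]
    _ ≤ _ := by
        apply ENNReal.ofReal_le_ofReal
        have h1 : ((4 * L ^ 5 : ℕ) : ℝ) ≤ Real.exp (c₀ * q) := by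
          have hL0 : (0 : ℝ) < L := by linarith
          calc ((4 * L ^ 5 : ℕ) : ℝ) = 4 * (L : ℝ) ^ 5 := by push_cast; ring
            _ ≤ (L : ℝ) ^ 4 * (L : ℝ) ^ 5 := by
                gcongr
                nlinarith [pow_le_pow_left₀ (by norm_num) hL4 4]
            _ = Real.exp (9 * Real.log L) := by
                rw [← pow_add, ← Real.exp_log (pow_pos hL0 _), Real.log_pow]
                norm_num
            _ ≤ _ := Real.exp_le_exp.mpr hlog
        calc _ ≤ Real.exp (c₀ * q) * Real.exp (-(2 * c₀ * q)) := by gcongr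
          _ = _ := by rw [← Real.exp_add]; ring_nf

lemma card_sqZ (a b : ℤ) (L : ℕ) : (sqZ a b L).card = L ^ 2 := by
  rw [sqZ, Finset.card_product, Int.card_Icc, Int.card_Icc, sq]
  congr 1 <;> omega

lemma abs_sub_le_of_mem_scaledSq {a b : ℤ} {L : ℕ} {y : ℤ × ℤ} (hy : y ∈ scaledSq a b L (1 / 2)) :
    |(y.1 : ℝ) - (a + ((L : ℝ) - 1) / 2)| ≤ 9 / 25 * L ∧
      |(y.2 : ℝ) - (b + ((L : ℝ) - 1) / 2)| ≤ 9 / 25 * L := by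
  have h : Real.sqrt (1 / 2) ≤ 18 / 25 := Real.sqrt_le_iff.mpr ⟨by norm_num, by norm_num⟩
  have h' : Real.sqrt (1 / 2) * L / 2 ≤ 9 / 25 * L := by
    nlinarith [mul_le_mul_of_nonneg_right h (Nat.cast_nonneg (α := ℝ) L)]
  exact ⟨hy.1.trans h', hy.2.trans h'⟩

lemma tSquare_subset_sqZ {a b : ℤ} {L s : ℕ} {x y : ℤ × ℤ} (hL : 100 ≤ L) (hs : 200 * s ≤ L)
    (hy : y ∈ scaledSq a b L (1 / 2))
    (hx : x ∈ Finset.Icc (y.1 - (s : ℤ)) (y.1 + s) ×ˢ Finset.Icc (y.2 - (s : ℤ)) (y.2 + s)) :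
    tSquare x (4 * s : ℕ) ⊆ (sqZ a b L : Set (ℤ × ℤ)) := by
  obtain ⟨h1, h2⟩ := abs_sub_le_of_mem_scaledSq hy
  rw [abs_le] at h1 h2
  intro n hn
  simp only [tSquare, tRect, Set.mem_ofPred_eq] at hn
  push_cast at hn
  simp only [Finset.mem_product, Finset.mem_Icc] at hx
  simp only [sqZ, Finset.coe_product, Finset.coe_Icc, Set.mem_prod, Set.mem_Icc]
  have hL' : (100 : ℝ) ≤ L := by exact_mod_cast hL
  have hs' : (200 : ℝ) * s ≤ L := by exact_mod_cast hs
  have h3 : (a : ℤ) + 5 * s ≤ y.1 := by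
    have : (a : ℝ) + 5 * s ≤ y.1 := by linarith
    exact_mod_cast this
  have h4 : y.1 + 5 * s + 1 ≤ a + L := by
    have : (y.1 : ℝ) + 5 * s + 1 ≤ a + L := by linarith
    exact_mod_cast this
  have h5 : (b : ℤ) + 5 * s ≤ y.2 := by
    have : (b : ℝ) + 5 * s ≤ y.2 := by linarith
    exact_mod_cast this
  have h6 : y.2 + 5 * s + 1 ≤ b + L := by
    have : (y.2 : ℝ) + 5 * s + 1 ≤ b + L := by linarith
    exact_mod_cast this
  omega

lemma SparseIn.inter_tSquare_one_eq_empty {ε : ℝ} {F : Set (ℤ × ℤ)} {c : ℤ × ℤ} (hε : 0 ≤ ε)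
    (hε' : 3 * ε < 1) (h : SparseIn ε F (tSquare c (1 : ℕ))) : F ∩ tSquare c (1 : ℕ) = ∅ := by
  rw [Set.eq_empty_iff_forall_notMem]
  intro n hn
  have h1 := h.ncard_outDiag_le c (false, false) (outCoord c (false, false) n)
  have h2 := ncard_tSquare_inter_outDiag_le c 1 (false, false) (outCoord c (false, false) n)
  have h3 : ((tSquare c (1 : ℕ) ∩ outDiag c (false, false) (outCoord c (false, false) n)).ncard : ℝ)
      ≤ 3 := by exact_mod_cast h2
  have h4 := eq_empty_of_ncard_lt_one
    (((finite_tSquare c (1 : ℕ)).subset Set.inter_subset_right).subset Set.inter_subset_left)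
    (lt_of_le_of_lt h1 (by nlinarith))
  have h5 : n ∈ F ∩ tSquare c (1 : ℕ) ∩ outDiag c (false, false) (outCoord c (false, false) n) :=
    ⟨hn, rfl⟩
  rw [h4] at h5
  exact h5

lemma ncard_exceptional_le {Λ : Finset (ℤ × ℤ)} {F : Set (ℤ × ℤ)} {ψ : ℤ × ℤ → ℝ} {δ : ℝ}
    (hδ : 0 ≤ δ) (h : (1 - δ) * ((Λ.filter (· ∉ F)).card : ℝ) ≤
      (((Λ.filter (· ∉ F)).filter (fun n => |ψ n| ≤ 1)).card : ℝ)) :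
    (({n | n ∈ Λ ∧ n ∉ F ∧ 1 < |ψ n|}).ncard : ℝ) ≤ δ * Λ.card := by
  have h1 : {n | n ∈ Λ ∧ n ∉ F ∧ 1 < |ψ n|}
      = ((Λ.filter (· ∉ F)).filter (fun n => ¬ |ψ n| ≤ 1) : Finset (ℤ × ℤ)) := by
    ext n
    simp only [Finset.coe_filter, Finset.mem_filter, Set.mem_ofPred_eq, not_le, and_assoc]
  rw [h1, Set.ncard_coe_finset]
  have h2 := Finset.card_filter_add_card_filter_not (s := Λ.filter (· ∉ F)) (fun n => |ψ n| ≤ 1)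
  have h3 : (((Λ.filter (· ∉ F)).filter (fun n => |ψ n| ≤ 1)).card : ℝ)
      + (((Λ.filter (· ∉ F)).filter (fun n => ¬ |ψ n| ≤ 1)).card : ℝ)
      = ((Λ.filter (· ∉ F)).card : ℝ) := by exact_mod_cast h2
  have h4 : ((Λ.filter (· ∉ F)).card : ℝ) ≤ Λ.card := by
    exact_mod_cast Finset.card_filter_le _ _
  nlinarith

/-- The deterministic part of the unique continuation theorem. -/
lemma abs_le_pow_of_stripsGood {a b : ℤ} {L : ℕ} {F : Set (ℤ × ℤ)} {v : ℤ × ℤ → ℝ}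
    {W : ((sqZ a b L).filter (· ∉ F) : Finset (ℤ × ℤ)) → ℝ} {E Eb : ℝ} {ψ : ℤ × ℤ → ℝ}
    (hψ : EigOn (fun n => if n ∈ F then v n else extV ((sqZ a b L).filter (· ∉ F)) W n) E ψ
      (sqZ a b L : Set (ℤ × ℤ)))
    {K c₀ ε D q : ℝ} (hK : 0 ≤ K)
    (hV : ∀ n ∈ sqZ a b L,
      |4 + (if n ∈ F then v n else extV ((sqZ a b L).filter (· ∉ F)) W n) - E| ≤ K)
    (hc : 0 < c₀) (hc1 : c₀ ≤ 1 / 64) (hε : 0 ≤ ε) (hεc : 800000000 * ε ≤ c₀ ^ 2) (hD : 1 ≤ D)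
    (hDL : D ≤ L) (hlogL : 1 ≤ Real.log L) (hq : 8 ≤ q) (hqL : q ^ 4 = L)
    (hlog : 9 * Real.log L ≤ c₀ * q) (hKL : 1 + (2 * q + 3) * (K + 2) ≤ L)
    (hE : |E - Eb| ≤ Real.exp (-24 * Real.sqrt (L * Real.log L)))
    (hF : RegularIn ε F (sqZ a b L : Set (ℤ × ℤ)))
    (hS : StripsGood (sqZ a b L) F v W ε c₀ D Eb L q)
    (hone : (1 - ε / Real.sqrt ((L : ℝ) * Real.log L)) * ((((sqZ a b L).filter (· ∉ F)).card : ℝ)) ≤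
      ((((sqZ a b L).filter (· ∉ F)).filter (fun n => |ψ n| ≤ 1)).card : ℝ))
    {y : ℤ × ℤ} (hy : y ∈ scaledSq a b L (1 / 2)) : |ψ y| ≤ (L : ℝ) ^ L := by
  have hL1 : (4096 : ℝ) ≤ L := by
    rw [← hqL]
    calc (4096 : ℝ) = 8 ^ 4 := by norm_num
      _ ≤ _ := pow_le_pow_left₀ (by norm_num) hq 4
  have hL2 : 4096 ≤ L := by exact_mod_cast hL1
  set s := L / 200 with hs
  have hsL : 200 * s ≤ L := Nat.mul_div_le L 200
  have hsL' : (L : ℝ) ≤ 200 * (2 * s + 1) := by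
    have : L ≤ 200 * (2 * s + 1) := by omega
    exact_mod_cast this
  have hs1 : 1 ≤ s := by omega
  have hsqrt1 : 1 ≤ Real.sqrt ((L : ℝ) * Real.log L) := by
    rw [Real.one_le_sqrt]
    nlinarith
  set A := {n | n ∈ sqZ a b L ∧ n ∉ F ∧ 1 < |ψ n|} with hA
  have hAfin : A.Finite := (sqZ a b L).finite_toSet.subset fun n hn => hn.1
  have hAcard := ncard_exceptional_le (div_nonneg hε (Real.sqrt_nonneg _)) hone
  rw [card_sqZ] at hAcard
  push_cast at hAcard
  set τ := c₀ ^ 2 / 1200 / Real.sqrt ((L : ℝ) * Real.log L) with hτ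
  have hτ0 : 0 < τ := by positivity
  have hε6 : ε ≤ c₀ ^ 2 / 800000000 := by linarith
  have hc2 : c₀ ^ 2 ≤ c₀ := by nlinarith
  have hτ1 : τ < 1 / 9 := by
    rw [hτ, div_lt_iff₀ (by linarith)]
    linarith
  set N := Finset.Icc (y.1 - (s : ℤ)) (y.1 + s) ×ˢ Finset.Icc (y.2 - (s : ℤ)) (y.2 + s) with hN
  have hNcard : (N.card : ℝ) = (2 * s + 1) ^ 2 := by
    have : N.card = (2 * s + 1) ^ 2 := by
      rw [hN, Finset.card_product, Int.card_Icc, Int.card_Icc, sq]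
      congr 1 <;> omega
    rw [this]; push_cast; ring
  obtain ⟨x, hxN, hx⟩ := exists_sparse_point (m := 4 * s) (N := N) hF hAfin hτ0
    (fun x hx => tSquare_subset_sqZ (by omega) hsL hy hx) (by
      have h1 : (A.ncard : ℝ) / τ ≤ 1200 * (ε / c₀ ^ 2) * L ^ 2 := by
        rw [div_le_iff₀ hτ0]
        refine hAcard.trans (le_of_eq ?_)
        rw [hτ]
        field_simp
      have h2 : ε / c₀ ^ 2 ≤ 1 / 800000000 := by
        rw [div_le_iff₀ (by positivity)]; linarith
      have h3 : ε ≤ 1 / 800000000 := by linarith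
      have h4 : (L : ℝ) ^ 2 ≤ 40000 * (2 * s + 1) ^ 2 := by
        calc (L : ℝ) ^ 2 ≤ (200 * (2 * s + 1)) ^ 2 := by gcongr
          _ = _ := by ring
      have h5 : 1200 * (ε / c₀ ^ 2) * (L : ℝ) ^ 2 ≤ 1200 * (1 / 800000000) * L ^ 2 := by gcongr
      have h6 : ε * (L : ℝ) ^ 2 ≤ 1 / 800000000 * L ^ 2 := by gcongr
      rw [hNcard, card_sqZ]
      push_cast
      have : (0 : ℝ) < (2 * s + 1) ^ 2 := by positivity
      linarith)
  have hsub := tSquare_subset_sqZ (by omega) hsL hy hxN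
  have hmono : ∀ R : ℕ, R ≤ 4 * s → tSquare x R ⊆ tSquare x (4 * s : ℕ) := by
    intro R hR n hn
    simp only [tSquare, tRect, Set.mem_ofPred_eq] at hn ⊢
    omega
  have hbase : ∀ n ∈ tSquare x (1 : ℕ), |ψ n| ≤ 1 := by
    intro n hn
    obtain ⟨h1, h2⟩ := hx 1 (by omega)
    have h3 := h1.inter_tSquare_one_eq_empty hε (by linarith)
    have h4 := eq_empty_of_ncard_lt_one (hAfin.subset Set.inter_subset_left)
      (lt_of_le_of_lt h2 (by norm_num; linarith))
    by_contra hcon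
    have hnF : n ∉ F := fun hnF => by
      have : n ∈ F ∩ tSquare x (1 : ℕ) := ⟨hnF, hn⟩
      rw [h3] at this
      exact this
    have : n ∈ A ∩ tSquare x (1 : ℕ) :=
      ⟨⟨hsub (hmono 1 (by omega) hn), hnF, not_le.mp hcon⟩, hn⟩
    rw [h4] at this
    exact this
  obtain ⟨r, hr, hbound⟩ := exists_abs_le_pow_tSquare (m := 2 * s) (X := (L : ℝ)) (by omega)
    (by linarith) hbase fun r B hr1 hrm hB hin => exists_growth_step hψ hK hV hc hc1 hε
      (by linarith) hD hDL hlogL (by linarith) hqL hlog hKL hE hS hr1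
      (by exact_mod_cast (by omega : 4 * r + 1 ≤ L)) hB
      ((hmono _ (by omega)).trans hsub) (hx _ (by omega)).1 (hx _ (by omega)).2 hin
  refine (hbound y ?_).trans (pow_le_pow_right₀ (by linarith) (by omega))
  simp only [hN, Finset.mem_product, Finset.mem_Icc] at hxN
  simp only [tSquare, tRect, Set.mem_ofPred_eq]
  omega

lemma exists_forall_le_of_large (D M : ℝ) {c₀ : ℝ} (hc : 0 < c₀) :
    ∃ A : ℝ, ∀ x : ℝ, A ≤ x → D ≤ x ∧ 1 ≤ Real.log x ∧ 8 ≤ x ^ ((1 : ℝ) / 4) ∧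
      (x ^ ((1 : ℝ) / 4)) ^ 4 = x ∧ 9 * Real.log x ≤ c₀ * x ^ ((1 : ℝ) / 4) ∧
      1 + (2 * x ^ ((1 : ℝ) / 4) + 3) * (M + 5 + 2) ≤ x := by
  have h1 := (isLittleO_log_rpow_atTop (by norm_num : (0 : ℝ) < 1 / 4)).bound
    (by positivity : 0 < c₀ / 9)
  have h2 := (tendsto_rpow_atTop (by norm_num : (0 : ℝ) < 1 / 4)).eventually_ge_atTop
    (max 8 (M + 7))
  rw [← Filter.eventually_atTop]
  filter_upwards [h1, h2, Filter.eventually_ge_atTop D, Filter.eventually_ge_atTop 1,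
    Real.tendsto_log_atTop.eventually_ge_atTop 1] with x h1 h2 h3 h4 h5
  have h0 : 0 < x := by linarith
  have h8 := (le_max_left _ _).trans h2
  have hM := (le_max_right _ _).trans h2
  have hpow : (x ^ ((1 : ℝ) / 4)) ^ 4 = x := by
    rw [← Real.rpow_natCast, ← Real.rpow_mul h0.le]
    norm_num
  refine ⟨h3, h5, h8, hpow, ?_, ?_⟩
  · rw [Real.norm_eq_abs, Real.norm_eq_abs, abs_of_nonneg (by linarith),
      abs_of_nonneg (by positivity)] at h1
    linarith
  · generalize x ^ ((1 : ℝ) / 4) = q at *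
    rw [← hpow]
    have : (2 * q + 3) * (M + 5 + 2) ≤ (2 * q + 3) * q := by gcongr; linarith
    have h64 : 64 ≤ q ^ 2 := by nlinarith
    have : 64 * q ^ 2 ≤ q ^ 2 * q ^ 2 := by gcongr
    nlinarith

/-- probabilistic unique continuation, with frozen sites. For
independent site measures `μ n` supported in `[0,M]` and uniformly anti-concentrated,
for every sufficiently small `ε > 0` there is `α > 1` such that for every
`Ē ∈ [0, 8+M]`, every square `Λ` of side length `L ≥ α`, every `F` that is `ε`-regular
in `Λ` and every `v : F → [0,M]`, with probability at least `1 − e^{−εL^{1/4}}` over the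
configuration on `Λ\F` the following holds: whenever `|E − Ē| ≤ e^{−α(L·log L)^{1/2}}`,
`Hψ = Eψ` in `Λ`, and `|ψ| ≤ 1` on a `1 − ε(L·log L)^{−1/2}` fraction of `Λ\F`, then
`|ψ| ≤ e^{αL·log L}` on `(1/2)Λ`. -/
theorem stmt_13 (M γ₀ ρ : ℝ) (hM : 0 < M) (hγ : 0 < γ₀) (hρ : 0 < ρ)
    (μ : ℤ × ℤ → Measure ℝ) [∀ n, IsProbabilityMeasure (μ n)]
    (hsupp : ∀ n, μ n (Set.Icc 0 M) = 1)
    (hac : ∀ n, ∀ t ∈ Set.Icc (0:ℝ) M, ENNReal.ofReal ρ ≤ μ n {s | γ₀ / 2 < |s - t|}) :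
    ∃ ε₀ > (0:ℝ), ∀ ε : ℝ, 0 < ε → ε ≤ ε₀ → ∃ α : ℝ, 1 < α ∧
      ∀ Ebar ∈ Set.Icc (0:ℝ) (8 + M), ∀ (a b : ℤ) (L : ℕ), α ≤ (L : ℝ) →
      ∀ F : Set (ℤ × ℤ), RegularIn ε F (sqZ a b L : Set (ℤ × ℤ)) →
      ∀ v : ℤ × ℤ → ℝ, (∀ n ∈ F, v n ∈ Set.Icc (0:ℝ) M) →
        1 - ENNReal.ofReal (Real.exp (-ε * (L : ℝ) ^ ((1:ℝ)/4))) ≤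
          Measure.pi (fun n : ((sqZ a b L).filter (· ∉ F) : Finset (ℤ × ℤ)) => μ n.1)
            {W | ∀ (E : ℝ) (ψ : ℤ × ℤ → ℝ),
              |E - Ebar| ≤ Real.exp (-α * Real.sqrt ((L : ℝ) * Real.log L)) →
              EigOn (fun n => if n ∈ F then v n
                  else extV ((sqZ a b L).filter (· ∉ F)) W n) E ψ
                (sqZ a b L : Set (ℤ × ℤ)) →
              ((1 - ε / Real.sqrt ((L : ℝ) * Real.log L)) *
                  ((((sqZ a b L).filter (· ∉ F)).card : ℝ)) ≤
                ((((sqZ a b L).filter (· ∉ F)).filter (fun n => |ψ n| ≤ 1)).card : ℝ)) →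
              ∀ n ∈ scaledSq a b L (1/2), |ψ n| ≤ Real.exp (α * L * Real.log L)} := by
  have hρ1 : ρ ≤ 1 := by
    have h := (hac 0 0 ⟨le_rfl, hM.le⟩).trans prob_le_one
    rwa [ENNReal.ofReal_le_one] at h
  set c₀ := ρ / 64 with hc
  have hc0 : 0 < c₀ := by positivity
  have hc1 : c₀ ≤ 1 / 64 := by rw [hc]; linarith
  have hc2 : c₀ ^ 2 ≤ c₀ := by nlinarith
  have hγ8 : 0 < 8 / γ₀ := by positivity
  set D := 4 * (M + 9) + 8 / γ₀ with hD
  obtain ⟨A, hA⟩ := exists_forall_le_of_large D M hc0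
  refine ⟨c₀ ^ 2 / 800000000, by positivity, fun ε hε hε₀ =>
    ⟨max A 24, lt_max_of_lt_right (by norm_num), ?_⟩⟩
  intro Ebar hEbar a b L hL F hF v hv
  obtain ⟨hDL, hlogL, hq8, hq4, hlog, hKL⟩ := hA L ((le_max_left _ _).trans hL)
  have hα : 24 ≤ max A 24 := le_max_right _ _
  set α := max A 24
  set q := (L : ℝ) ^ ((1 : ℝ) / 4) with hq
  have hL0 : (0 : ℝ) < L := by rw [← hq4]; positivity
  set P := Measure.pi (fun n : ((sqZ a b L).filter (· ∉ F) : Finset (ℤ × ℤ)) => μ n.1) with hP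
  have hnull : P {W | ∃ n, W n ∉ Set.Icc 0 M} = 0 :=
    measure_pi_exists_notMem_eq_zero _ measurableSet_Icc fun n => hsupp n
  have hstrips : P {W | ¬ StripsGood (sqZ a b L) F v W ε c₀ D Ebar L q} ≤
      ENNReal.ofReal (Real.exp (-c₀ * q)) :=
    measure_not_stripsGood_le μ hM.le hγ hρ hρ1 hsupp hac hEbar le_rfl hc hε.le (by linarith)
      hq8 (card_sqZ a b L) hDL hlog F hv
  rw [tsub_le_iff_right]
  set S := {W : ((sqZ a b L).filter (· ∉ F) : Finset (ℤ × ℤ)) → ℝ | ∀ (E : ℝ) (ψ : ℤ × ℤ → ℝ), _}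
  have hcompl : Sᶜ ⊆ {W | ∃ n, W n ∉ Set.Icc 0 M} ∪
      {W | ¬ StripsGood (sqZ a b L) F v W ε c₀ D Ebar L q} := by
    intro W hW
    by_contra hcon
    rw [Set.mem_union, not_or] at hcon
    obtain ⟨hW1, hW2⟩ := hcon
    rw [Set.mem_ofPred_eq] at hW1 hW2
    push Not at hW1 hW2
    refine hW fun E ψ hE hψ hone y hy => ?_
    have hl : 0 ≤ Real.sqrt ((L : ℝ) * Real.log L) := Real.sqrt_nonneg _
    have hE1 : |E - Ebar| ≤ 1 := hE.trans (Real.exp_le_one_iff.mpr (by nlinarith))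
    refine (abs_le_pow_of_stripsGood hψ (K := M + 5) (D := D) (by linarith) ?_ hc0 hc1 hε.le
      (by linarith) (by linarith) hDL hlogL hq8 hq4 hlog hKL
      (hE.trans (Real.exp_le_exp.mpr (by nlinarith))) hF hW2 hone hy).trans ?_
    · intro n hn
      have hVn : (if n ∈ F then v n else extV ((sqZ a b L).filter (· ∉ F)) W n) ∈ Set.Icc 0 M := by
        split_ifs with hnF
        · exact hv n hnF
        · unfold extV
          rw [dif_pos (Finset.mem_filter.mpr ⟨hn, hnF⟩)]
          exact hW1 _
      rw [abs_le] at hE1 ⊢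
      constructor <;> linarith [hVn.1, hVn.2, hEbar.1, hEbar.2]
    · rw [← Real.exp_log (pow_pos hL0 L), Real.exp_le_exp, Real.log_pow]
      nlinarith [mul_pos hL0 (by linarith : 0 < Real.log L)]
  calc (1 : ENNReal) = P Set.univ := measure_univ.symm
    _ ≤ P S + P Sᶜ := by rw [← Set.union_compl_self S]; exact measure_union_le _ _
    _ ≤ P S + (P {W | ∃ n, W n ∉ Set.Icc 0 M} +
          P {W | ¬ StripsGood (sqZ a b L) F v W ε c₀ D Ebar L q}) := by
        gcongr
        exact (measure_mono hcompl).trans (measure_union_le _ _)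
    _ ≤ P S + ENNReal.ofReal (Real.exp (-ε * q)) := by
        rw [hnull, zero_add]
        gcongr
        refine hstrips.trans (ENNReal.ofReal_le_ofReal (Real.exp_le_exp.mpr ?_))
        have : ε ≤ c₀ := by linarith
        nlinarith
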